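/- There exists a real number t₀ such that every zero ρ of Riemann's auxiliary function R with Im ρ ≥ t₀ satisfies Re ρ < 1. -/

import Mathlib

open MeasureTheory

/-- The straight line of slope 1 crossing the real axis at `1/2`,
parametrized from upper right to lower left. -/
noncomputable def rline (u : ℝ) : ℂ :=
  1 / 2 - Complex.exp (Real.pi * Complex.I / 4) * (u : ℂ)

/-- Riemann's auxiliary function
`R(s) = ∫_{0↙1} x^{-s} e^{πix²}/(e^{πix} − e^{-πix}) dx`, written out as an
integral over the real parameter of the line `0↙1`. Here `z ^ (-s)` is the
principal power `exp (−s Log z)`. -/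
noncomputable def RiemannR (s : ℂ) : ℂ :=
  -Complex.exp (Real.pi * Complex.I / 4) *
    ∫ u : ℝ, (rline u) ^ (-s) *
      Complex.exp (Real.pi * Complex.I * (rline u) ^ 2) /
      (Complex.exp (Real.pi * Complex.I * rline u) -
        Complex.exp (-(Real.pi * Complex.I * rline u)))

noncomputable def ee (x : ℝ) : ℂ := Complex.exp (2 * Real.pi * x * Complex.I)

lemma norm_ee (x : ℝ) : ‖ee x‖ = 1 := by
  unfold ee
  have : (2 * Real.pi * x * Complex.I : ℂ) = ((2 * Real.pi * x : ℝ) : ℂ) * Complex.I := by push_cast; ring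
  rw [this, Complex.norm_exp_ofReal_mul_I]

lemma ee_add (x y : ℝ) : ee (x + y) = ee x * ee y := by
  unfold ee; rw [← Complex.exp_add]; congr 1; push_cast; ring

lemma ee_int (k : ℤ) : ee k = 1 := by
  unfold ee
  rw [Complex.exp_eq_one_iff]; exact ⟨k, by push_cast; ring⟩

lemma ee_sub_int (x : ℝ) (k : ℤ) : ee (x - k) = ee x := by
  have := ee_add (x - k) k
  rw [ee_int, sub_add_cancel, mul_one] at this; exact this.symm

/-- half cotangent value -/
noncomputable def hcot (φ : ℝ) : ℝ := Real.cos (Real.pi * φ) / Real.sin (Real.pi * φ) / 2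

lemma ee_mul_hcot (φ : ℝ) (h : Real.sin (Real.pi * φ) ≠ 0) :
    (ee φ - 1) * (-(1/2) - hcot φ * Complex.I) = 1 := by
  have e1 : ee φ = Complex.cos (2 * (Real.pi * φ)) + Complex.sin (2 * (Real.pi * φ)) * Complex.I := by
    unfold ee; rw [← Complex.exp_mul_I]; congr 1; ring
  rw [e1, Complex.cos_two_mul, Complex.sin_two_mul]
  unfold hcot
  push_cast
  have h' : Complex.sin (Real.pi * φ) ≠ 0 := by exact_mod_cast h
  have h2 := Complex.sin_sq_add_cos_sq (Real.pi * φ)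
  have h3 := Complex.I_sq
  set S := Complex.sin (Real.pi * φ)
  set C := Complex.cos (Real.pi * φ)
  field_simp
  have h4 : C ^ 2 = 1 - S ^ 2 := by linear_combination h2
  have h5 : C ^ 3 = C * (1 - S^2) := by rw [← h4]; ring
  ring_nf
  simp only [h3, h4, h5]
  ring

lemma sin_lower {δ φ : ℝ} (hδ : 0 < δ) (h1 : δ ≤ φ) (h2 : φ ≤ 1 - δ) :
    2 * δ ≤ Real.sin (Real.pi * φ) := by
  have hpi := Real.pi_pos
  have key : ∀ x : ℝ, δ ≤ x → x ≤ 1/2 → 2 * δ ≤ Real.sin (Real.pi * x) := by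
    intro x hx1 hx2
    have := Real.mul_le_sin (x := Real.pi * x) (by nlinarith) (by nlinarith)
    have e : 2 / Real.pi * (Real.pi * x) = 2 * x := by field_simp
    rw [e] at this; linarith
  rcases le_total φ (1/2) with h | h
  · exact key φ h1 h
  · have := key (1 - φ) (by linarith) (by linarith)
    rwa [show Real.pi * (1 - φ) = Real.pi - Real.pi * φ by ring, Real.sin_pi_sub] at this

lemma hcot_anti {δ x y : ℝ} (hδ : 0 < δ) (h1 : δ ≤ x) (hxy : x ≤ y) (h2 : y ≤ 1 - δ) :
    hcot y ≤ hcot x := by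
  have hx := sin_lower hδ h1 (by linarith : x ≤ 1 - δ)
  have hy := sin_lower hδ (by linarith : δ ≤ y) h2
  have hpi := Real.pi_pos
  unfold hcot
  have : Real.cos (Real.pi * y) / Real.sin (Real.pi * y) ≤ Real.cos (Real.pi * x) / Real.sin (Real.pi * x) := by
    rw [div_le_div_iff₀ (by linarith) (by linarith)]
    have h3 : 0 ≤ Real.sin (Real.pi * y - Real.pi * x) :=
      Real.sin_nonneg_of_nonneg_of_le_pi (by nlinarith) (by nlinarith)
    rw [Real.sin_sub] at h3
    linarith
  linarith

lemma hcot_abs {δ x : ℝ} (hδ : 0 < δ) (h1 : δ ≤ x) (h2 : x ≤ 1 - δ) :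
    |hcot x| ≤ 1 / (4 * δ) := by
  have hx := sin_lower hδ h1 h2
  unfold hcot
  rw [abs_div, abs_div, abs_of_pos (by linarith : 0 < Real.sin (Real.pi * x)), abs_two, div_div,
    div_le_div_iff₀ (by linarith) (by linarith)]
  have := Real.abs_cos_le_one (Real.pi * x)
  nlinarith [abs_nonneg (Real.cos (Real.pi * x))]

lemma c_norm {δ x : ℝ} (hδ : 0 < δ) (h1 : δ ≤ x) (h2 : x ≤ 1 - δ) :
    ‖(-(1/2) - hcot x * Complex.I : ℂ)‖ ≤ 1 / (2 * δ) := by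
  have h := hcot_abs hδ h1 h2
  have hd : δ ≤ 1/2 := by linarith
  calc ‖(-(1/2) - hcot x * Complex.I : ℂ)‖ ≤ ‖(-(1/2) : ℂ)‖ + ‖(hcot x * Complex.I : ℂ)‖ := norm_sub_le _ _
    _ = 1/2 + |hcot x| := by simp
    _ ≤ 1/(4*δ) + 1/(4*δ) := by
        have : (1:ℝ)/2 ≤ 1/(4*δ) := by
          rw [div_le_div_iff₀ (by norm_num) (by linarith)]; linarith
        linarith
    _ = 1 / (2*δ) := by field_simp; norm_num

lemma kusmin_landau (f : ℕ → ℝ) (a b : ℕ) (k : ℤ) (δ : ℝ) (hδ : 0 < δ) (hab : a < b)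
    (h1 : ∀ n, a ≤ n → n < b → k + δ ≤ f (n+1) - f n)
    (h2 : ∀ n, a ≤ n → n < b → f (n+1) - f n ≤ k + 1 - δ)
    (hm : ∀ n, a ≤ n → n + 1 < b → f (n+1) - f n ≤ f (n+2) - f (n+1)) :
    ‖∑ n ∈ Finset.Ico a b, ee (f n)‖ ≤ 2 / δ := by
  set φ : ℕ → ℝ := fun n => f (n+1) - f n - k with hφ
  set c : ℕ → ℂ := fun n => -(1/2) - hcot (φ n) * Complex.I with hc
  have hφ1 : ∀ n, a ≤ n → n < b → δ ≤ φ n := fun n x y => by have := h1 n x y; simp only [hφ]; linarith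
  have hφ2 : ∀ n, a ≤ n → n < b → φ n ≤ 1 - δ := fun n x y => by have := h2 n x y; simp only [hφ]; linarith
  have hz : ∀ n, a ≤ n → n < b → ee (f n) = (ee (f (n+1)) - ee (f n)) * c n := by
    intro n x y
    have hs := sin_lower hδ (hφ1 n x y) (hφ2 n x y)
    have e := ee_mul_hcot (φ n) (by linarith)
    have e2 : ee (f (n+1)) = ee (f n) * ee (φ n) := by
      simp only [hφ]; rw [ee_sub_int, ← ee_add]; congr 1; ring
    rw [e2]
    have : (ee (f n) * ee (φ n) - ee (f n)) * c n = ee (f n) * ((ee (φ n) - 1) * c n) := by ring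
    rw [this, e, mul_one]
  have key : ∀ m, a + m < b →
      ‖∑ n ∈ Finset.Ico a (a+m+1), ee (f n) - ee (f (a+m+1)) * c (a+m)‖ ≤ ‖c a‖ + (hcot (φ a) - hcot (φ (a+m))) := by
    intro m
    induction m with
    | zero =>
      intro hb
      simp only [add_zero, sub_self]
      rw [show Finset.Ico a (a+1) = {a} by simp, Finset.sum_singleton]
      have := hz a le_rfl hab
      have e : ee (f a) - ee (f (a+1)) * c a = - (ee (f a) * c a) := by
        linear_combination this
      rw [e, norm_neg, norm_mul, norm_ee, one_mul]
    | succ m ih =>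
      intro hb
      have ih := ih (by omega)
      have hz' := hz (a+m+1) (by omega) (by omega)
      rw [show a + (m+1) + 1 = (a+m+1)+1 by ring, Finset.sum_Ico_succ_top (by omega),
        show a + (m+1) = a+m+1 by ring]
      have e : ∑ n ∈ Finset.Ico a (a+m+1), ee (f n) + ee (f (a+m+1)) - ee (f (a+m+1+1)) * c (a+m+1)
          = (∑ n ∈ Finset.Ico a (a+m+1), ee (f n) - ee (f (a+m+1)) * c (a+m))
            + ee (f (a+m+1)) * (c (a+m) - c (a+m+1)) := by linear_combination hz'
      rw [e]
      refine (norm_add_le _ _).trans ?_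
      have hcc : c (a+m) - c (a+m+1) = ((hcot (φ (a+m+1)) - hcot (φ (a+m)) : ℝ) : ℂ) * Complex.I := by
        simp only [hc]; push_cast; ring
      have han : hcot (φ (a+m+1)) ≤ hcot (φ (a+m)) :=
        hcot_anti hδ (hφ1 _ (by omega) (by omega))
          (by have := hm (a+m) (by omega) (by omega); simp only [hφ]; 
              rw [show a+m+1+1 = a+m+2 by ring]; linarith) (hφ2 _ (by omega) (by omega))
      rw [norm_mul, norm_ee, hcc, norm_mul, Complex.norm_I, Complex.norm_real, Real.norm_eq_abs,
        abs_of_nonpos (by linarith)]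
      linarith
  obtain ⟨m, rfl⟩ : ∃ m, b = a + m + 1 := ⟨b - a - 1, by omega⟩
  have k1 := key m (by omega)
  have ha1 := c_norm hδ (hφ1 a le_rfl hab) (hφ2 a le_rfl hab)
  have hb1 := c_norm hδ (hφ1 (a+m) (by omega) (by omega)) (hφ2 (a+m) (by omega) (by omega))
  have ha2 := hcot_abs hδ (hφ1 a le_rfl hab) (hφ2 a le_rfl hab)
  have hb2 := hcot_abs hδ (hφ1 (a+m) (by omega) (by omega)) (hφ2 (a+m) (by omega) (by omega))
  have k2 : ‖ee (f (a+m+1)) * c (a+m)‖ ≤ 1 / (2*δ) := by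
    rw [norm_mul, norm_ee, one_mul]; exact hb1
  have k3 : ‖∑ n ∈ Finset.Ico a (a+m+1), ee (f n)‖ ≤
      ‖∑ n ∈ Finset.Ico a (a+m+1), ee (f n) - ee (f (a+m+1)) * c (a+m)‖ + ‖ee (f (a+m+1)) * c (a+m)‖ := by
    have := norm_add_le (∑ n ∈ Finset.Ico a (a+m+1), ee (f n) - ee (f (a+m+1)) * c (a+m)) (ee (f (a+m+1)) * c (a+m))
    rwa [sub_add_cancel] at this
  have e1 : 1 / (2*δ) = 1/2 * (1/δ) := by field_simp
  have e2 : 1 / (4*δ) = 1/4 * (1/δ) := by field_simp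
  have e3 : 2 / δ = 2 * (1/δ) := by field_simp
  have e4 : 0 < 1/δ := by positivity
  have ha1' : ‖c a‖ ≤ 1/(2*δ) := ha1
  obtain ⟨_, _⟩ := abs_le.1 ha2
  obtain ⟨_, _⟩ := abs_le.1 hb2
  linarith

lemma v2 (f : ℕ → ℝ) (L : ℕ) (lam Lam δ : ℝ) (hδ : 0 < δ) (hl : 0 < lam) (hlL : lam ≤ Lam)
    (h1 : ∀ n, n < L → lam ≤ (f (n+2) - f (n+1)) - (f (n+1) - f n))
    (h2 : ∀ n, n < L → (f (n+2) - f (n+1)) - (f (n+1) - f n) ≤ Lam) :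
    ‖∑ n ∈ Finset.range L, ee (f n)‖ ≤ (Lam * L + 2) * (2 * (δ / lam + 1) + 2 / δ) := by
  set θ : ℕ → ℝ := fun n => f (n+1) - f n with hθ
  have hlow : ∀ n m, n ≤ m → m ≤ L → lam * (m - n : ℝ) ≤ θ m - θ n := by
    intro n m hnm
    induction m, hnm using Nat.le_induction with
    | base => intro _; simp
    | succ m hm ih =>
      intro h
      have := ih (by omega)
      have := h1 m (by omega)
      simp only [hθ] at *; push_cast; rw [show m+1+1 = m+2 by ring]; linarith
  have hup : ∀ m, m ≤ L → θ m ≤ θ 0 + Lam * m := by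
    intro m
    induction m with
    | zero => simp
    | succ m ih =>
      intro h
      have := ih (by omega)
      have := h2 m (by omega)
      simp only [hθ] at *; push_cast; rw [show m+1+1 = m+2 by ring]; linarith
  have hmono : ∀ n m, n ≤ m → m ≤ L → θ n ≤ θ m := by
    intro n m h h'
    have := hlow n m h h'
    have h3 : (n:ℝ) ≤ m := by exact_mod_cast h
    nlinarith
  -- cardinality of sets where θ varies little
  have hcard : ∀ s : Finset ℕ, s ⊆ Finset.range L → (∀ n ∈ s, ∀ m ∈ s, θ m - θ n ≤ δ) →
      ‖∑ n ∈ s, ee (f n)‖ ≤ δ / lam + 1 := by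
    intro s hs hv
    have hc : ‖∑ n ∈ s, ee (f n)‖ ≤ s.card := by
      refine (norm_sum_le _ _).trans ?_
      simp [norm_ee]
    refine hc.trans ?_
    rcases s.eq_empty_or_nonempty with rfl | hne
    · simp; positivity
    · have hmin := s.min'_mem hne
      have hmax := s.max'_mem hne
      have hle : s.min' hne ≤ s.max' hne := s.min'_le _ hmax
      have hsub : s ⊆ Finset.Icc (s.min' hne) (s.max' hne) := fun x hx =>
        Finset.mem_Icc.2 ⟨s.min'_le _ hx, s.le_max' _ hx⟩
      have hc1 := Finset.card_le_card hsub
      rw [Nat.card_Icc] at hc1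
      have hb := hlow _ _ hle (le_of_lt (Finset.mem_range.1 (hs hmax)))
      have hv' := hv _ hmin _ hmax
      have : ((s.max' hne : ℝ) - s.min' hne) ≤ δ / lam := by
        rw [le_div_iff₀ hl]; linarith
      have hc2 : (s.card : ℝ) ≤ (s.max' hne : ℝ) + 1 - s.min' hne := by
        have h5 : s.card + s.min' hne ≤ s.max' hne + 1 := by omega
        have h6 : ((s.card + s.min' hne : ℕ) : ℝ) ≤ (s.max' hne + 1 : ℕ) := by exact_mod_cast h5
        push_cast at h6; linarith
      linarith
  have hmid : ∀ k : ℤ, ‖∑ n ∈ (Finset.range L).filter (fun n => k + δ ≤ θ n ∧ θ n ≤ k + 1 - δ), ee (f n)‖ ≤ 2 / δ := by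
    intro k
    set s := (Finset.range L).filter (fun n => k + δ ≤ θ n ∧ θ n ≤ k + 1 - δ) with hs
    rcases s.eq_empty_or_nonempty with h | hne
    · rw [h]; simp; positivity
    · have hmin := s.min'_mem hne
      have hmax := s.max'_mem hne
      have hle : s.min' hne ≤ s.max' hne := s.min'_le _ hmax
      have hmin' := (Finset.mem_filter.1 hmin)
      have hmax' := (Finset.mem_filter.1 hmax)
      have hLm := Finset.mem_range.1 hmax'.1
      have heq : s = Finset.Ico (s.min' hne) (s.max' hne + 1) := by
        ext x
        constructor
        · intro hx
          rw [Finset.mem_Ico]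
          exact ⟨s.min'_le _ hx, Nat.lt_succ_of_le (s.le_max' _ hx)⟩
        · intro hx
          rw [Finset.mem_Ico] at hx
          have a1 := hmono _ _ hx.1 (by omega)
          have a2 := hmono _ _ (Nat.lt_succ_iff.1 hx.2) (by omega)
          rw [hs, Finset.mem_filter, Finset.mem_range]
          exact ⟨by omega, by linarith [hmin'.2.1], by linarith [hmax'.2.2]⟩
      rw [heq]
      apply kusmin_landau f _ _ k δ hδ (by omega)
      · intro n x y
        have a1 := hmono _ _ x (by omega)
        exact hmin'.2.1.trans a1
      · intro n x y
        have a2 := hmono _ _ (Nat.lt_succ_iff.1 y) (by omega)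
        exact a2.trans hmax'.2.2
      · intro n x y
        exact hmono n (n+1) (by omega) (by omega)
  have hclass : ∀ k : ℤ, ‖∑ n ∈ (Finset.range L).filter (fun n => ⌊θ n⌋ = k), ee (f n)‖ ≤ 2 * (δ / lam + 1) + 2 / δ := by
    intro k
    set s := (Finset.range L).filter (fun n => ⌊θ n⌋ = k) with hs
    have e1 := Finset.sum_filter_add_sum_filter_not s (fun n => θ n < k + δ) (fun n => ee (f n))
    set s' := s.filter (fun n => ¬ θ n < k + δ) with hs'
    have e2 := Finset.sum_filter_add_sum_filter_not s' (fun n => k + 1 - δ < θ n) (fun n => ee (f n))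
    have hks : ∀ n ∈ s, (k:ℝ) ≤ θ n ∧ θ n < k + 1 := by
      intro n hn
      have := (Finset.mem_filter.1 hn).2
      exact Int.floor_eq_iff.1 this
    have b1 := hcard (s.filter (fun n => θ n < k + δ))
      ((Finset.filter_subset _ _).trans (Finset.filter_subset _ _)) (by
        intro n hn m hm
        have h3 := Finset.mem_filter.1 hn
        have h4 := Finset.mem_filter.1 hm
        have := hks n h3.1
        linarith [h4.2, this.1])
    have b2 := hcard (s'.filter (fun n => k + 1 - δ < θ n))
      ((Finset.filter_subset _ _).trans ((Finset.filter_subset _ _).trans (Finset.filter_subset _ _))) (by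
        intro n hn m hm
        have h3 := Finset.mem_filter.1 hn
        have h4 := Finset.mem_filter.1 hm
        have := hks m (Finset.mem_filter.1 h4.1).1
        linarith [h3.2, this.2])
    have b3 := hmid k
    have e3 : s'.filter (fun n => ¬ (k + 1 - δ < θ n)) =
        (Finset.range L).filter (fun n => k + δ ≤ θ n ∧ θ n ≤ k + 1 - δ) := by
      ext x
      simp only [hs', hs, Finset.mem_filter, not_lt]
      constructor
      · rintro ⟨⟨⟨a, b⟩, c⟩, d⟩; exact ⟨a, c, d⟩
      · rintro ⟨a, c, d⟩
        refine ⟨⟨⟨a, ?_⟩, c⟩, d⟩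
        rw [Int.floor_eq_iff]; constructor <;> linarith
    rw [← e3] at b3
    rw [← e1, ← e2]
    refine (norm_add_le _ _).trans ?_
    have := norm_add_le (∑ n ∈ s'.filter (fun n => k + 1 - δ < θ n), ee (f n)) (∑ n ∈ s'.filter (fun n => ¬ (k + 1 - δ < θ n)), ee (f n))
    linarith
  have hmaps : ∀ n ∈ Finset.range L, ⌊θ n⌋ ∈ Finset.Icc ⌊θ 0⌋ ⌊θ 0 + Lam * L⌋ := by
    intro n hn
    have hn := Finset.mem_range.1 hn
    rw [Finset.mem_Icc]
    refine ⟨Int.floor_le_floor (hmono 0 n (by omega) (by omega)), Int.floor_le_floor ?_⟩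
    have := hup n (by omega)
    have h3 : (n:ℝ) ≤ L := by exact_mod_cast hn.le
    nlinarith
  rw [← Finset.sum_fiberwise_of_maps_to hmaps]
  refine (norm_sum_le _ _).trans ?_
  refine (Finset.sum_le_sum (fun k _ => hclass k)).trans ?_
  rw [Finset.sum_const, nsmul_eq_mul]
  have hLam : 0 ≤ Lam * L := by have : 0 < Lam := by linarith
                                positivity
  apply mul_le_mul_of_nonneg_right _ (by positivity)
  rw [Int.card_Icc]
  have h5 : ⌊θ 0⌋ ≤ ⌊θ 0 + Lam * L⌋ := Int.floor_le_floor (by linarith)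
  have h6 : (((⌊θ 0 + Lam * L⌋ + 1 - ⌊θ 0⌋).toNat : ℕ) : ℝ) = ⌊θ 0 + Lam * L⌋ + 1 - ⌊θ 0⌋ := by
    have : (((⌊θ 0 + Lam * L⌋ + 1 - ⌊θ 0⌋).toNat : ℤ)) = ⌊θ 0 + Lam * L⌋ + 1 - ⌊θ 0⌋ := Int.toNat_of_nonneg (by omega)
    exact_mod_cast this
  rw [h6]
  have := Int.floor_le (θ 0 + Lam * L)
  have := Int.lt_floor_add_one (θ 0)
  linarith

lemma v2' (f : ℕ → ℝ) (L : ℕ) (lam Lam : ℝ) (hl : 0 < lam) (hl1 : lam ≤ 1) (hlL : lam ≤ Lam)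
    (h1 : ∀ n, n < L → lam ≤ (f (n+2) - f (n+1)) - (f (n+1) - f n))
    (h2 : ∀ n, n < L → (f (n+2) - f (n+1)) - (f (n+1) - f n) ≤ Lam) :
    ‖∑ n ∈ Finset.range L, ee (f n)‖ ≤ 6 * (Lam * L + 2) / Real.sqrt lam := by
  have hs : 0 < Real.sqrt lam := Real.sqrt_pos.2 hl
  have := v2 f L lam Lam (Real.sqrt lam) hs hl hlL h1 h2
  refine this.trans ?_
  have hs1 : Real.sqrt lam ≤ 1 := Real.sqrt_le_one.2 hl1
  have e : Real.sqrt lam / lam = 1 / Real.sqrt lam := by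
    rw [div_eq_div_iff hl.ne' hs.ne', one_mul, Real.mul_self_sqrt hl.le]
  rw [e]
  have h3 : 1 ≤ 1 / Real.sqrt lam := by rw [le_div_iff₀ hs]; linarith
  have hLam : 0 ≤ Lam * L := by have : 0 < Lam := by linarith
                                positivity
  rw [show 6 * (Lam * L + 2) / Real.sqrt lam = (Lam * L + 2) * (6 * (1/Real.sqrt lam)) by ring]
  apply mul_le_mul_of_nonneg_left _ (by positivity)
  rw [show 2 / Real.sqrt lam = 2 * (1 / Real.sqrt lam) by ring]
  linarith

lemma le_of_sq_le_sq0 {a b : ℝ} (h : a^2 ≤ b^2) (hb : 0 ≤ b) : a ≤ b :=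
  (abs_le.1 (abs_le_of_sq_le_sq h hb)).2

lemma a_process (z : ℕ → ℂ) (L H : ℕ) (B : ℝ) (hB : 0 ≤ B) (hH : 1 ≤ H) (hz : ∀ n, ‖z n‖ ≤ 1)
    (hcor : ∀ d, 1 ≤ d → d < H →
      ‖∑ n ∈ Finset.range (L - d), z (n + d) * (starRingEnd ℂ) (z n)‖ ≤ B) :
    ‖∑ n ∈ Finset.range L, z n‖ ^ 2 ≤ (L + H) * (L / H + B) := by
  set S := ∑ n ∈ Finset.range L, z n with hS
  set w : ℕ → ℂ := fun m => if H ≤ m ∧ m < H + L then z (m - H) else 0 with hw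
  have hw0 : ∀ m, ¬ (H ≤ m ∧ m < H + L) → w m = 0 := fun m h => if_neg h
  have hw1 : ∀ n, n < L → w (H + n) = z n := by
    intro n hn
    simp only [hw]; rw [if_pos ⟨by omega, by omega⟩]; congr 1; omega
  have hshift : ∀ h, h < H → ∀ (d : ℕ) (G : ℕ → ℂ), d < H → (∀ j, ¬ (H ≤ j ∧ j + d < H + L) → G j = 0) →
      ∑ m ∈ Finset.range (L + H), G (m + h) = ∑ n ∈ Finset.range (L - d), G (H + n) := by
    intro h hh d G hd hG
    have e1 : ∑ m ∈ Finset.range (L + H), G (m + h) = ∑ j ∈ Finset.Ico h (L + H + h), G j := by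
      rw [Finset.sum_Ico_eq_sum_range]
      rw [show L + H + h - h = L + H by omega]
      exact Finset.sum_congr rfl (fun m _ => by rw [add_comm])
    have e2 : ∑ n ∈ Finset.range (L - d), G (H + n) = ∑ j ∈ Finset.Ico H (H + (L - d)), G j := by
      rw [Finset.sum_Ico_eq_sum_range]
      rw [show H + (L-d) - H = L-d by omega]
    rw [e1, e2]
    symm
    apply Finset.sum_subset
    · intro x hx
      rw [Finset.mem_Ico] at *; omega
    · intro x hx hx'
      apply hG
      rw [Finset.mem_Ico] at *; omega
  have hsum : ∀ h, h < H → ∑ m ∈ Finset.range (L + H), w (m + h) = S := by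
    intro h hh
    rw [hshift h hh 0 w (by omega) (fun j hj => hw0 j (by simpa using hj))]
    exact Finset.sum_congr rfl (fun n hn => hw1 n (by simpa using hn))
  have hcor2 : ∀ d h, h + d < H → ‖∑ m ∈ Finset.range (L + H), w (m + (h + d)) * (starRingEnd ℂ) (w (m + h))‖
      ≤ (if d = 0 then (L:ℝ) else 0) + B := by
    intro d h hh
    have e := hshift h (by omega) d (fun j => w (j + d) * (starRingEnd ℂ) (w j)) (by omega) (by
      intro j hj
      by_cases h1 : H ≤ j ∧ j < H + L
      · have : w (j + d) = 0 := hw0 _ (by omega)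
        simp only [this, zero_mul]
      · simp only [hw0 j h1, map_zero, mul_zero])
    have e' : ∑ m ∈ Finset.range (L + H), w (m + (h + d)) * (starRingEnd ℂ) (w (m + h)) =
        ∑ n ∈ Finset.range (L - d), z (n + d) * (starRingEnd ℂ) (z n) := by
      rw [show ∑ m ∈ Finset.range (L + H), w (m + (h + d)) * (starRingEnd ℂ) (w (m + h)) =
        ∑ m ∈ Finset.range (L + H), w (m + h + d) * (starRingEnd ℂ) (w (m + h)) by simp only [add_assoc]]
      rw [e]
      apply Finset.sum_congr rfl
      intro n hn
      have hn := Finset.mem_range.1 hn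
      rw [hw1 n (by omega), show H + n + d = H + (n + d) by ring, hw1 (n+d) (by omega)]
    rw [e']
    by_cases hd : d = 0
    · subst hd
      rw [if_pos rfl]
      refine (norm_sum_le _ _).trans ?_
      have : ∀ n ∈ Finset.range (L - 0), ‖z (n+0) * (starRingEnd ℂ) (z n)‖ ≤ 1 := by
        intro n _
        rw [norm_mul, RCLike.norm_conj]
        have := hz n
        have := norm_nonneg (z n)
        simp only [add_zero]
        nlinarith
      refine (Finset.sum_le_sum this).trans ?_
      simp; exact hB
    · rw [if_neg hd, zero_add]
      exact hcor d (by omega) (by omega)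
  have hcor3 : ∀ h1 h2, h1 < H → h2 < H → ‖∑ m ∈ Finset.range (L + H), w (m + h1) * (starRingEnd ℂ) (w (m + h2))‖
      ≤ (if h1 = h2 then (L:ℝ) else 0) + B := by
    intro h1 h2 a1 a2
    rcases le_total h2 h1 with h | h
    · obtain ⟨d, rfl⟩ := Nat.exists_eq_add_of_le h
      refine (hcor2 d h2 a1).trans (le_of_eq ?_)
      congr 1
      by_cases hd : d = 0 <;> simp [hd]
    · obtain ⟨d, rfl⟩ := Nat.exists_eq_add_of_le h
      have := hcor2 d h1 a2
      rw [← RCLike.norm_conj, map_sum] at this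
      simp only [map_mul, RingHomCompTriple.comp_apply, RingHom.id_apply] at this
      rw [show ∑ m ∈ Finset.range (L + H), w (m + h1) * (starRingEnd ℂ) (w (m + (h1 + d))) =
        ∑ m ∈ Finset.range (L + H), (starRingEnd ℂ) (w (m + (h1+d))) * (w (m + h1)) from
        Finset.sum_congr rfl (fun m _ => mul_comm _ _)]
      refine this.trans (le_of_eq ?_)
      congr 1
      by_cases hd : d = 0 <;> simp [hd]
  set A : ℕ → ℂ := fun m => ∑ h ∈ Finset.range H, w (m + h) with hA
  have hHS : (H : ℂ) * S = ∑ m ∈ Finset.range (L + H), A m := by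
    rw [hA, Finset.sum_comm, Finset.sum_congr rfl (fun h hh => hsum h (Finset.mem_range.1 hh))]
    simp
  have hCS : (H * ‖S‖) ^ 2 ≤ (L + H) * ∑ m ∈ Finset.range (L + H), ‖A m‖ ^ 2 := by
    have h1 : H * ‖S‖ ≤ ∑ m ∈ Finset.range (L + H), ‖A m‖ := by
      have : ‖(H : ℂ) * S‖ = H * ‖S‖ := by rw [norm_mul]; simp
      rw [← this, hHS]; exact norm_sum_le _ _
    have h2 := sq_sum_le_card_mul_sum_sq (s := Finset.range (L + H)) (f := fun m => ‖A m‖)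
    simp only [Finset.card_range] at h2
    push_cast at h2
    refine le_trans ?_ h2
    exact pow_le_pow_left₀ (by positivity) h1 2
  have hA2 : ((∑ m ∈ Finset.range (L + H), ‖A m‖ ^ 2 : ℝ) : ℂ) =
      ∑ h1 ∈ Finset.range H, ∑ h2 ∈ Finset.range H, ∑ m ∈ Finset.range (L + H), w (m + h1) * (starRingEnd ℂ) (w (m + h2)) := by
    have : ∀ m, ((‖A m‖ ^ 2 : ℝ) : ℂ) = ∑ h1 ∈ Finset.range H, ∑ h2 ∈ Finset.range H, w (m + h1) * (starRingEnd ℂ) (w (m + h2)) := by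
      intro m
      push_cast
      rw [← Complex.mul_conj', hA]
      simp only [map_sum]
      rw [Finset.sum_mul_sum]
    rw [Complex.ofReal_sum]
    rw [Finset.sum_congr rfl (fun m _ => this m), Finset.sum_comm]
    apply Finset.sum_congr rfl
    intro h1 _
    rw [Finset.sum_comm]
  have hA3 : ∑ m ∈ Finset.range (L + H), ‖A m‖ ^ 2 ≤ H * L + H ^ 2 * B := by
    have h0 : 0 ≤ ∑ m ∈ Finset.range (L + H), ‖A m‖ ^ 2 := by positivity
    have : ∑ m ∈ Finset.range (L + H), ‖A m‖ ^ 2 = ‖((∑ m ∈ Finset.range (L + H), ‖A m‖ ^ 2 : ℝ) : ℂ)‖ := by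
      rw [Complex.norm_real, Real.norm_of_nonneg h0]
    rw [this, hA2]
    refine (norm_sum_le _ _).trans ?_
    refine (Finset.sum_le_sum (fun h1 hh1 => (norm_sum_le _ _).trans (Finset.sum_le_sum (fun h2 hh2 =>
      hcor3 h1 h2 (Finset.mem_range.1 hh1) (Finset.mem_range.1 hh2))))).trans ?_
    simp only [Finset.sum_add_distrib, Finset.sum_ite_eq, Finset.sum_const, Finset.card_range, nsmul_eq_mul]
    rw [Finset.sum_congr rfl (fun h hh => if_pos hh)]
    simp only [Finset.sum_const, Finset.card_range, nsmul_eq_mul]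
    apply le_of_eq; ring
  have hHp : (0:ℝ) < H := by exact_mod_cast hH
  have h5 : (H * ‖S‖) ^ 2 ≤ (L + H) * (H * L + H ^ 2 * B) :=
    hCS.trans (mul_le_mul_of_nonneg_left hA3 (by positivity))
  have h6 : (L + H : ℝ) * (L / H + B) = ((L + H) * (H * L + H ^ 2 * B)) / H^2 := by field_simp
  rw [h6, le_div_iff₀ (by positivity)]
  linarith [mul_pow (H:ℝ) ‖S‖ 2]

/-- the phase of `n ^ (-i t)` with `t = 2 π τ` -/
noncomputable def fph (τ : ℝ) (M n : ℕ) : ℝ := -(τ * Real.log ((M : ℝ) + n))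

lemma fph_second (τ : ℝ) (M n : ℕ) (hM : 1 ≤ M) :
    (fph τ M (n+2) - fph τ M (n+1)) - (fph τ M (n+1) - fph τ M n) =
      τ * Real.log (1 + 1 / (((M:ℝ)+n) * ((M:ℝ)+n+2))) := by
  have hM' : (1:ℝ) ≤ M := by exact_mod_cast hM
  have hn : (0:ℝ) ≤ n := by positivity
  unfold fph
  push_cast
  have e : 1 + 1 / (((M:ℝ)+n) * ((M:ℝ)+n+2)) = ((M:ℝ)+(n+1)) ^ 2 / (((M:ℝ)+n) * ((M:ℝ)+(n+2))) := by
    field_simp; ring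
  rw [e, Real.log_div (by positivity) (by positivity), Real.log_pow, Real.log_mul (by positivity) (by positivity)]
  push_cast; ring

lemma log_one_add_lower {x : ℝ} (hx : 0 ≤ x) : x / (1 + x) ≤ Real.log (1 + x) := by
  have h := Real.one_sub_inv_le_log_of_pos (show 0 < 1 + x by linarith)
  have : x / (1+x) = 1 - (1+x)⁻¹ := by field_simp; ring
  linarith

lemma log_one_add_upper {x : ℝ} (hx : 0 ≤ x) : Real.log (1 + x) ≤ x := by
  have h := Real.log_le_sub_one_of_pos (show 0 < 1 + x by linarith)
  linarith

/-- second derivative test on a dyadic block -/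
lemma block2 (τ : ℝ) (M L : ℕ) (hτ : 1 ≤ τ) (hM : 1 ≤ M) (hL : L ≤ M) (h : τ ≤ 4 * (M:ℝ)^2) :
    ‖∑ n ∈ Finset.range L, ee (fph τ M n)‖ ≤ 48 * (Real.sqrt τ + M / Real.sqrt τ) := by
  have hM' : (1:ℝ) ≤ M := by exact_mod_cast hM
  have hL' : (L:ℝ) ≤ M := by exact_mod_cast hL
  have hb := v2' (fph τ M) L (τ / (4 * (M:ℝ)^2)) (τ / (M:ℝ)^2) (by positivity)
    (by rw [div_le_one (by positivity)]; exact h)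
    (by apply div_le_div_of_nonneg_left (by linarith) (by positivity); nlinarith)
    (by
      intro n hn
      rw [fph_second τ M n hM]
      have hn' : (n:ℝ) + 1 ≤ M := by exact_mod_cast (show n + 1 ≤ M by omega)
      have hn0 : (0:ℝ) ≤ n := by positivity
      have h1 := log_one_add_lower (x := 1 / (((M:ℝ)+n) * ((M:ℝ)+n+2))) (by positivity)
      have h2 : 1 / (4 * (M:ℝ)^2) ≤ 1 / (((M:ℝ)+n) * ((M:ℝ)+n+2)) / (1 + 1 / (((M:ℝ)+n) * ((M:ℝ)+n+2))) := by
        have : 1 / (((M:ℝ)+n) * ((M:ℝ)+n+2)) / (1 + 1 / (((M:ℝ)+n) * ((M:ℝ)+n+2))) = 1 / ((M:ℝ)+n+1)^2 := by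
          field_simp; ring
        rw [this]
        apply div_le_div_of_nonneg_left (by norm_num) (by positivity)
        nlinarith
      rw [show τ / (4 * (M:ℝ)^2) = τ * (1 / (4 * (M:ℝ)^2)) by ring]
      exact mul_le_mul_of_nonneg_left (h2.trans h1) (by linarith))
    (by
      intro n hn
      rw [fph_second τ M n hM]
      have hn0 : (0:ℝ) ≤ n := by positivity
      have h1 := log_one_add_upper (x := 1 / (((M:ℝ)+n) * ((M:ℝ)+n+2))) (by positivity)
      have h2 : 1 / (((M:ℝ)+n) * ((M:ℝ)+n+2)) ≤ 1 / (M:ℝ)^2 := by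
        apply div_le_div_of_nonneg_left (by norm_num) (by positivity)
        nlinarith
      rw [show τ / (M:ℝ)^2 = τ * (1 / (M:ℝ)^2) by ring]
      exact mul_le_mul_of_nonneg_left (h1.trans h2) (by linarith))
  refine hb.trans ?_
  have hs : 0 < Real.sqrt τ := Real.sqrt_pos.2 (by linarith)
  have hss := Real.mul_self_sqrt (show 0 ≤ τ by linarith)
  have e : Real.sqrt (τ / (4 * (M:ℝ)^2)) = Real.sqrt τ / (2 * M) := by
    rw [Real.sqrt_div (by linarith), show 4 * (M:ℝ)^2 = (2 * M)^2 by ring, Real.sqrt_sq (by positivity)]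
  rw [e, div_le_iff₀ (by positivity)]
  have h1 : 48 * (Real.sqrt τ + M / Real.sqrt τ) * (Real.sqrt τ / (2 * M)) = 24 * (τ / M) + 24 := by
    field_simp
    rw [pow_two, hss]; ring
  rw [h1]
  have h2 : τ / (M:ℝ)^2 * L ≤ τ / M := by
    rw [show τ / (M:ℝ)^2 * L = τ * L / (M:ℝ)^2 by ring, div_le_div_iff₀ (by positivity) (by positivity)]
    have : τ * L * M ≤ τ * M * M := by gcongr
    nlinarith
  have : 0 ≤ τ / M := by positivity
  nlinarith

/-- differenced phase -/
noncomputable def gph (τ : ℝ) (M d n : ℕ) : ℝ := fph τ M n - fph τ M (n + d)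

lemma gph_second (τ : ℝ) (M d n : ℕ) (hM : 1 ≤ M) :
    (gph τ M d (n+2) - gph τ M d (n+1)) - (gph τ M d (n+1) - gph τ M d n) =
      τ * (Real.log (1 + 1 / (((M:ℝ)+n) * ((M:ℝ)+n+2))) - Real.log (1 + 1 / (((M:ℝ)+(n+d)) * ((M:ℝ)+(n+d)+2)))) := by
  have h1 := fph_second τ M n hM
  have h2 := fph_second τ M (n+d) hM
  unfold gph
  push_cast at h2
  rw [show n + 2 + d = n + d + 2 by ring, show n + 1 + d = n + d + 1 by ring]
  rw [mul_sub, ← h1, ← h2]; ring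

lemma gph_bounds (x d M : ℝ) (hd : 1 ≤ d) (hM : 1 ≤ M) (hx : M ≤ x) (hx2 : x + d + 1 ≤ 2 * M) :
    d / (48 * M^3) ≤ Real.log (1 + 1 / (x * (x+2))) - Real.log (1 + 1 / ((x+d) * (x+d+2))) ∧
    Real.log (1 + 1 / (x * (x+2))) - Real.log (1 + 1 / ((x+d) * (x+d+2))) ≤ 2 * d / M^3 := by
  have hx0 : 0 < x := by linarith
  set A := 1 / (x * (x+2)) with hA
  set B := 1 / ((x+d) * (x+d+2)) with hB
  have hA0 : 0 < A := by positivity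
  have hB0 : 0 < B := by positivity
  have hA1 : A ≤ 1 := by rw [hA, div_le_one (by positivity)]; nlinarith
  have hAB : A - B = d * (2 * x + d + 2) / (x * (x+2) * (x+d) * (x+d+2)) := by
    rw [hA, hB]; field_simp; ring
  have hAB0 : 0 ≤ A - B := by rw [hAB]; positivity
  have e : Real.log (1 + A) - Real.log (1 + B) = Real.log (1 + (A - B) / (1 + B)) := by
    rw [← Real.log_div (by positivity) (by positivity)]; congr 1; field_simp; ring
  rw [e]
  have hq : 0 ≤ (A - B) / (1 + B) := by positivity
  constructor
  · refine le_trans ?_ (log_one_add_lower hq)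
    have e2 : (A - B) / (1 + B) / (1 + (A - B) / (1 + B)) = (A - B) / (1 + A) := by
      field_simp; ring
    rw [e2]
    have h1 : (A - B) / 2 ≤ (A - B) / (1 + A) :=
      div_le_div_of_nonneg_left hAB0 (by positivity) (by linarith)
    refine le_trans ?_ h1
    have h2 : d / (24 * M^3) ≤ A - B := by
      rw [hAB]
      have h3 : d / (x * (x+2) * (x+d)) ≤ d * (2 * x + d + 2) / (x * (x+2) * (x+d) * (x+d+2)) := by
        rw [div_le_div_iff₀ (by positivity) (by positivity)]
        have : 0 ≤ d * (x * (x+2) * (x+d)) * x := by positivity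
        nlinarith
      refine le_trans ?_ h3
      apply div_le_div_of_nonneg_left (by linarith) (by positivity)
      calc x * (x+2) * (x+d) ≤ (2*M) * (4*M) * (3*M) := by gcongr <;> linarith
        _ = 24 * M^3 := by ring
    have : d / (48 * M^3) = d / (24 * M^3) / 2 := by field_simp; norm_num
    linarith
  · refine (log_one_add_upper hq).trans ?_
    refine (div_le_self hAB0 (by linarith)).trans ?_
    rw [hAB, div_le_div_iff₀ (by positivity) (by positivity)]
    calc d * (2 * x + d + 2) * M^3 ≤ d * (2 * (x + d + 2)) * (x * (x+2) * (x+d)) := by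
          have : M^3 ≤ x * (x+2) * (x+d) := by
            calc M^3 = M*M*M := by ring
              _ ≤ _ := by gcongr <;> linarith
          gcongr
          linarith
      _ = _ := by ring

set_option maxHeartbeats 1000000 in
lemma block3 (τ : ℝ) (M L : ℕ) (hM : 1 ≤ M) (hL : L ≤ M) (h : τ ≤ 4 * (M:ℝ)^2)
    (h' : (M:ℝ)^3 ≤ τ^2) (hτ : 1 ≤ τ) :
    ‖∑ n ∈ Finset.range L, ee (fph τ M n)‖ ^ 2 ≤ 10000 * (M:ℝ) * (M:ℝ)^(3/4:ℝ) := by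
  have hM' : (1:ℝ) ≤ M := by exact_mod_cast hM
  have hL' : (L:ℝ) ≤ M := by exact_mod_cast hL
  set H := Nat.sqrt M with hH
  have hH1 : 1 ≤ H := by rw [hH, Nat.le_sqrt]; omega
  have hH2 : H * H ≤ M := Nat.sqrt_le M
  have hH3 : M < (H+1)*(H+1) := Nat.lt_succ_sqrt M
  have hH1' : (1:ℝ) ≤ H := by exact_mod_cast hH1
  have hH2' : (H:ℝ) * H ≤ M := by exact_mod_cast hH2
  have hH3' : (M:ℝ) ≤ 4 * (H * H) := by
    have : (M:ℝ) < (H+1)*(H+1) := by exact_mod_cast hH3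
    nlinarith
  set q := (M:ℝ)^(1/4:ℝ) with hq
  have hq0 : 0 < q := by positivity
  have hq4 : q^4 = M := by
    rw [hq, ← Real.rpow_natCast, ← Real.rpow_mul (by positivity)]; norm_num
  have hq3 : (M:ℝ)^(3/4:ℝ) = q^3 := by
    rw [hq, ← Real.rpow_natCast, ← Real.rpow_mul (by positivity)]; norm_num
  have hq1 : 1 ≤ q := Real.one_le_rpow hM' (by norm_num)
  have hHq : (H:ℝ) ≤ q^2 := by
    apply le_of_sq_le_sq0 _ (by positivity)
    nlinarith
  have hHq2 : q^2 ≤ 2 * H := by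
    apply le_of_sq_le_sq0 _ (by positivity)
    nlinarith
  have hp := a_process (fun n => ee (fph τ M n)) L H (4900 * q^3) (by positivity) hH1
    (fun n => (norm_ee _).le) (by
      intro d hd1 hdH
      have hd1' : (1:ℝ) ≤ d := by exact_mod_cast hd1
      have hdH' : (d:ℝ) ≤ H := by exact_mod_cast hdH.le
      have conv : ‖∑ n ∈ Finset.range (L - d), ee (fph τ M (n + d)) * (starRingEnd ℂ) (ee (fph τ M n))‖
          = ‖∑ n ∈ Finset.range (L - d), ee (gph τ M d n)‖ := by
        rw [← RCLike.norm_conj, map_sum]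
        congr 1
        apply Finset.sum_congr rfl
        intro n _
        have hc : ∀ x, (starRingEnd ℂ) (ee x) = ee (-x) := by
          intro x; unfold ee; rw [← Complex.exp_conj]; simp [map_ofNat (starRingEnd ℂ) 2]
        rw [map_mul, Complex.conj_conj, hc, ← ee_add]
        unfold gph; congr 1; ring
      rw [conv]
      rcases le_or_gt L (d+1) with hLd | hLd
      · refine (norm_sum_le _ _).trans ?_
        simp only [norm_ee, Finset.sum_const, Finset.card_range, nsmul_eq_mul, mul_one]
        have : ((L - d : ℕ) : ℝ) ≤ 1 := by exact_mod_cast (by omega)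
        have : 1 ≤ q^3 := one_le_pow₀ hq1
        linarith
      have hdM : (d:ℝ) ≤ M := by nlinarith
      set lam := τ * (d / (48 * (M:ℝ)^3)) with hlam
      have hlam0 : 0 < lam := by positivity
      have hlamq : lam * (12 * q^2) ≤ 1 := by
        have h3 : lam ≤ 4 * (M:ℝ)^2 * (q^2 / (48 * (M:ℝ)^3)) := by
          rw [hlam]; gcongr; linarith
        have h4 : 4 * (M:ℝ)^2 * (q^2 / (48 * (M:ℝ)^3)) * (12 * q^2) = 1 := by
          rw [← hq4]; field_simp; norm_num
        calc _ ≤ _ := mul_le_mul_of_nonneg_right h3 (by positivity)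
          _ = 1 := h4
      have hlam1 : lam ≤ 1 := by nlinarith [one_le_pow₀ hq1 (n := 2)]
      have hbd := v2' (gph τ M d) (L - d - 1) lam (τ * (2 * d / (M:ℝ)^3)) hlam0 hlam1
        (by rw [hlam]; apply mul_le_mul_of_nonneg_left _ (by linarith)
            rw [div_le_div_iff₀ (by positivity) (by positivity)]
            have : 0 < (d:ℝ) * (M:ℝ)^3 := by positivity
            nlinarith)
        (by intro n hn
            rw [gph_second τ M d n hM]
            have hn' : (n:ℝ) + d + 1 ≤ M := by exact_mod_cast (show n + d + 1 ≤ M by omega)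
            have := (gph_bounds (M + n) d M hd1' hM' (by linarith [(Nat.cast_nonneg n : (0:ℝ) ≤ n)]) (by linarith)).1
            rw [hlam]
            rw [← add_assoc]
            exact mul_le_mul_of_nonneg_left this (by linarith))
        (by intro n hn
            rw [gph_second τ M d n hM]
            have hn' : (n:ℝ) + d + 1 ≤ M := by exact_mod_cast (show n + d + 1 ≤ M by omega)
            have := (gph_bounds (M + n) d M hd1' hM' (by linarith [(Nat.cast_nonneg n : (0:ℝ) ≤ n)]) (by linarith)).2
            rw [← add_assoc]
            exact mul_le_mul_of_nonneg_left this (by linarith))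
      have hsplit : ‖∑ n ∈ Finset.range (L - d), ee (gph τ M d n)‖ ≤
          ‖∑ n ∈ Finset.range (L - d - 1), ee (gph τ M d n)‖ + 1 := by
        rw [show L - d = (L - d - 1) + 1 by omega, Finset.sum_range_succ]
        refine (norm_add_le _ _).trans ?_
        rw [norm_ee]; simp
      refine hsplit.trans ?_
      have hs0 : 0 < Real.sqrt lam := Real.sqrt_pos.2 hlam0
      have hss := Real.mul_self_sqrt hlam0.le
      have e96 : τ * (2 * d / (M:ℝ)^3) = 96 * lam := by rw [hlam]; field_simp; norm_num
      rw [e96] at hbd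
      have hLd' : ((L - d - 1 : ℕ) : ℝ) ≤ M := by exact_mod_cast (by omega)
      have h5 : 6 * (96 * lam * ((L - d - 1 : ℕ) : ℝ) + 2) / Real.sqrt lam ≤
          576 * M * Real.sqrt lam + 12 * (1 / Real.sqrt lam) := by
        rw [div_le_iff₀ hs0]
        have : (576 * M * Real.sqrt lam + 12 * (1 / Real.sqrt lam)) * Real.sqrt lam = 576 * M * lam + 12 := by
          have : (576 * M * Real.sqrt lam + 12 * (1 / Real.sqrt lam)) * Real.sqrt lam =
            576 * M * (Real.sqrt lam * Real.sqrt lam) + 12 := by field_simp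
          rw [this, hss]
        rw [this]
        have : lam * ((L - d - 1 : ℕ) : ℝ) ≤ lam * M := by gcongr
        linarith
      have h6 : Real.sqrt lam * q ≤ 1 := by
        apply le_of_sq_le_sq0 _ (by norm_num)
        rw [mul_pow, pow_two (Real.sqrt lam), hss]
        nlinarith
      have h7 : (M:ℝ) * Real.sqrt lam ≤ q^3 := by
        rw [← hq4, show q^4 * Real.sqrt lam = q^3 * (Real.sqrt lam * q) by ring]
        have : 0 < q^3 := by positivity
        nlinarith
      have h8 : 1 / Real.sqrt lam ≤ 7 * q^3 := by
        rw [div_le_iff₀ hs0]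
        have hτq : q^6 ≤ τ := by
          apply le_of_sq_le_sq0 _ (by linarith)
          calc (q^6)^2 = (q^4)^3 := by ring
            _ ≤ τ^2 := by rw [hq4]; exact h'
        have h9 : 1 ≤ 49 * q^6 * lam := by
          have : q^6 * (1 / (48 * (M:ℝ)^3)) ≤ lam := by
            rw [hlam]; gcongr
          have h10 : 48 * q^6 * (q^6 * (1 / (48 * (M:ℝ)^3))) = 1 := by
            rw [← hq4]; field_simp
          have h11 : 0 < q^6 := by positivity
          nlinarith
        apply le_of_sq_le_sq0 _ (by positivity)
        rw [mul_pow, pow_two (Real.sqrt lam), hss]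
        linarith [show (7 * q^3)^2 * lam = 49 * q^6 * lam by ring]
      have : 1 ≤ q^3 := one_le_pow₀ hq1
      linarith)
  refine hp.trans ?_
  rw [hq3]
  have h1 : (L:ℝ) / H ≤ 2 * q^3 := by
    rw [div_le_iff₀ (by linarith)]
    have : (M:ℝ) ≤ 2 * q^2 * H := by
      rw [← hq4]; nlinarith [sq_nonneg q]
    have h2 : q^2 ≤ q^3 := pow_le_pow_right₀ hq1 (by norm_num)
    nlinarith
  have h2 : (L:ℝ) + H ≤ 2 * M := by nlinarith
  calc ((L:ℝ) + H) * (L / H + 4900 * q^3) ≤ (2 * M) * (2 * q^3 + 4900 * q^3) := by gcongr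
    _ ≤ _ := by have : 0 < (M:ℝ) * q^3 := by positivity
                nlinarith

lemma block_bound (τ : ℝ) (M L : ℕ) (hτ : 1 ≤ τ) (hM : 1 ≤ M) (hL : L ≤ M) (h : τ ≤ 4 * (M:ℝ)^2) :
    ‖∑ n ∈ Finset.range L, ee (fph τ M n)‖ ≤ 200 * (M * τ^(-(1/16):ℝ)) := by
  have hM' : (1:ℝ) ≤ M := by exact_mod_cast hM
  have hτ0 : 0 < τ := by linarith
  set r := τ^(1/16:ℝ) with hr
  have hr0 : 0 < r := by positivity
  have hr1 : 1 ≤ r := Real.one_le_rpow hτ (by norm_num)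
  have hrinv : τ^(-(1/16):ℝ) = 1 / r := by rw [Real.rpow_neg hτ0.le, ← hr, inv_eq_one_div]
  have hr16 : r^16 = τ := by
    rw [hr, ← Real.rpow_natCast, ← Real.rpow_mul (by positivity)]; norm_num
  rw [hrinv]
  rcases le_or_gt ((M:ℝ)^3) (τ^2) with h' | h'
  · have hb := block3 τ M L hM hL h h' hτ
    apply le_of_sq_le_sq0 _ (by positivity)
    refine hb.trans ?_
    set q := (M:ℝ)^(1/4:ℝ) with hq
    have hq0 : 0 < q := by positivity
    have hq4 : q^4 = M := by
      rw [hq, ← Real.rpow_natCast, ← Real.rpow_mul (by positivity)]; norm_num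
    have hq3 : (M:ℝ)^(3/4:ℝ) = q^3 := by
      rw [hq, ← Real.rpow_natCast, ← Real.rpow_mul (by positivity)]; norm_num
    have hrq : r^2 ≤ 2 * q := by
      have : (r^2)^8 ≤ (2*q)^8 := by
        calc (r^2)^8 = r^16 := by ring
          _ ≤ 4 * (q^4)^2 := by rw [hr16, hq4]; exact h
          _ ≤ 256 * (q^4)^2 := by gcongr; norm_num
          _ = (2*q)^8 := by ring
      exact le_of_pow_le_pow_left₀ (by norm_num) (by positivity) this
    rw [hq3, ← hq4]
    have e : (200 * (q^4 * (1/r)))^2 = 40000 * q^8 / r^2 := by field_simp; norm_num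
    rw [e, le_div_iff₀ (by positivity)]
    have : 0 < q^7 := by positivity
    nlinarith
  · have hb := block2 τ M L hτ hM hL h
    refine hb.trans ?_
    have hs : Real.sqrt τ = r^8 := by
      rw [← hr16, show r^16 = (r^8)^2 by ring, Real.sqrt_sq (by positivity)]
    rw [hs]
    have h1 : r^9 ≤ M := by
      have : (r^9)^3 ≤ (M:ℝ)^3 := by
        calc (r^9)^3 = r^27 := by ring
          _ ≤ r^32 := pow_le_pow_right₀ hr1 (by norm_num)
          _ = (r^16)^2 := by ring
          _ ≤ _ := by rw [hr16]; exact h'.le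
      exact le_of_pow_le_pow_left₀ (by norm_num) (by positivity) this
    have h2 : r^8 ≤ M * (1/r) := by
      rw [mul_one_div, le_div_iff₀ hr0]; calc r^8*r = r^9 := by ring
        _ ≤ _ := h1
    have h3 : M / r^8 ≤ M * (1/r) := by
      rw [mul_one_div]
      apply div_le_div_of_nonneg_left (by positivity) hr0
      calc r = r^1 := by ring
        _ ≤ r^8 := pow_le_pow_right₀ hr1 (by norm_num)
    have : 0 < M * (1/r) := by positivity
    linarith

lemma abel_bound (a : ℕ → ℝ) (z : ℕ → ℂ) (L : ℕ) (B : ℝ) (ha : ∀ n, a (n+1) ≤ a n) (ha0 : ∀ n, 0 ≤ a n)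
    (hB : ∀ l ≤ L, ‖∑ n ∈ Finset.range l, z n‖ ≤ B) :
    ‖∑ n ∈ Finset.range L, (a n : ℂ) * z n‖ ≤ a 0 * B := by
  have key : ∀ l, ∑ n ∈ Finset.range l, (a n : ℂ) * z n = (a l : ℂ) * ∑ n ∈ Finset.range l, z n +
      ∑ n ∈ Finset.range l, ((a n - a (n+1) : ℝ) : ℂ) * ∑ j ∈ Finset.range (n+1), z j := by
    intro l
    induction l with
    | zero => simp
    | succ l ih =>
      rw [Finset.sum_range_succ, ih, Finset.sum_range_succ (n := l) (f := fun n => ((a n - a (n+1) : ℝ) : ℂ) * ∑ j ∈ Finset.range (n+1), z j),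
        Finset.sum_range_succ (n := l) (f := z)]
      push_cast; ring
  rw [key]
  refine (norm_add_le _ _).trans ?_
  have h1 : ‖(a L : ℂ) * ∑ n ∈ Finset.range L, z n‖ ≤ a L * B := by
    rw [norm_mul, Complex.norm_real, Real.norm_of_nonneg (ha0 L)]
    exact mul_le_mul_of_nonneg_left (hB L le_rfl) (ha0 L)
  have h2 : ‖∑ n ∈ Finset.range L, ((a n - a (n+1) : ℝ) : ℂ) * ∑ j ∈ Finset.range (n+1), z j‖ ≤ (a 0 - a L) * B := by
    refine (norm_sum_le _ _).trans ?_
    rw [← Finset.sum_range_sub' a L, Finset.sum_mul]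
    apply Finset.sum_le_sum
    intro n hn
    have hn := Finset.mem_range.1 hn
    have : 0 ≤ a n - a (n+1) := by linarith [ha n]
    rw [norm_mul, Complex.norm_real, Real.norm_of_nonneg this]
    exact mul_le_mul_of_nonneg_left (hB (n+1) (by omega)) this
  linarith

lemma cpow_eq_ee (n : ℕ) (hn : 1 ≤ n) (s : ℂ) :
    (n:ℂ)^(-s) = (((n:ℝ)^(-s.re) : ℝ) : ℂ) * ee (-(s.im / (2 * Real.pi) * Real.log n)) := by
  have hn0 : (n:ℂ) ≠ 0 := by exact_mod_cast (by omega : n ≠ 0)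
  have hn1 : (0:ℝ) < n := by exact_mod_cast hn
  have hpi : (Real.pi : ℂ) ≠ 0 := by exact_mod_cast Real.pi_ne_zero
  rw [Complex.cpow_def_of_ne_zero hn0, Real.rpow_def_of_pos hn1, Complex.ofReal_exp]
  unfold ee
  rw [← Complex.exp_add, ← Complex.natCast_log]
  congr 1
  conv_lhs => rw [← Complex.re_add_im s]
  push_cast
  field_simp
  ring

lemma norm_cpow_nat (n : ℕ) (hn : 1 ≤ n) (s : ℂ) : ‖(n:ℂ)^(-s)‖ = (n:ℝ)^(-s.re) := by
  rw [cpow_eq_ee n hn, norm_mul, norm_ee, mul_one, Complex.norm_real, Real.norm_of_nonneg (by positivity)]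

lemma dir_block (s : ℂ) (τ : ℝ) (hs : 1 ≤ s.re) (ht : s.im = 2 * Real.pi * τ) (M : ℕ) (hτ : 1 ≤ τ)
    (hM : 1 ≤ M) (h : τ ≤ 4 * (M:ℝ)^2) :
    ‖∑ n ∈ Finset.Ico M (2*M), (n:ℂ)^(-s)‖ ≤ 200 * τ^(-(1/16):ℝ) := by
  have hM' : (1:ℝ) ≤ M := by exact_mod_cast hM
  rw [Finset.sum_Ico_eq_sum_range, show 2*M - M = M by omega]
  have e : ∀ n, ((M + n : ℕ):ℂ)^(-s) = ((((M + n : ℕ):ℝ)^(-s.re) : ℝ) : ℂ) * ee (fph τ M n) := by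
    intro n
    rw [cpow_eq_ee (M+n) (by omega)]
    have : s.im / (2 * Real.pi) = τ := by rw [ht]; field_simp
    rw [this]; unfold fph; push_cast; rfl
  simp only [e]
  have hb := abel_bound (fun n => ((M + n : ℕ):ℝ)^(-s.re)) (fun n => ee (fph τ M n)) M (200 * (M * τ^(-(1/16):ℝ)))
    (by intro n
        apply Real.rpow_le_rpow_of_nonpos
        · exact_mod_cast (by omega)
        · push_cast; linarith
        · linarith)
    (by intro n; positivity)
    (fun l hl => block_bound τ M l hτ hM hl h)
  refine hb.trans ?_
  simp only [add_zero]
  have h1 : (M:ℝ)^(-s.re) ≤ (M:ℝ)⁻¹ := by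
    rw [← Real.rpow_neg_one]
    exact Real.rpow_le_rpow_of_exponent_le hM' (by linarith)
  calc (M:ℝ)^(-s.re) * (200 * (M * τ^(-(1/16):ℝ))) ≤ (M:ℝ)⁻¹ * (200 * (M * τ^(-(1/16):ℝ))) := by gcongr
    _ = _ := by field_simp

lemma dir_dyadic (s : ℂ) (τ : ℝ) (hs : 1 ≤ s.re) (ht : s.im = 2 * Real.pi * τ) (M : ℕ) (hτ : 1 ≤ τ)
    (hM : 1 ≤ M) (h : τ ≤ 4 * (M:ℝ)^2) (K : ℕ) :
    ‖∑ n ∈ Finset.Ico M (2^K*M), (n:ℂ)^(-s)‖ ≤ K * (200 * τ^(-(1/16):ℝ)) := by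
  have hM' : (1:ℝ) ≤ M := by exact_mod_cast hM
  induction K with
  | zero => simp
  | succ K ih =>
    have hle : M ≤ 2^K*M := Nat.le_mul_of_pos_left _ (by positivity)
    have hle' : (M:ℝ) ≤ ((2^K*M : ℕ) : ℝ) := by exact_mod_cast hle
    rw [← Finset.sum_Ico_consecutive _ hle (by rw [pow_succ]; nlinarith : 2^K*M ≤ 2^(K+1)*M)]
    have := dir_block s τ hs ht (2^K*M) hτ (by omega) (h.trans (by gcongr))
    rw [show 2 * (2^K*M) = 2^(K+1)*M by ring] at this
    refine (norm_add_le _ _).trans ?_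
    push_cast at *; linarith

lemma step_bound (n : ℕ) (hn : 1 ≤ n) (s : ℂ) (hs : 1 ≤ s.re) (hs1 : s ≠ 1) :
    ‖(n:ℂ)^(-s) - ((n:ℂ)^(1-s) - ((n+1:ℕ):ℂ)^(1-s)) / (s-1)‖ ≤ ‖s‖ / (n:ℝ)^2 := by
  have hn1 : (1:ℝ) ≤ n := by exact_mod_cast hn
  have hs0 : s ≠ 0 := by rintro rfl; simp at hs; linarith
  have hs1' : s - 1 ≠ 0 := sub_ne_zero.2 hs1
  have hder : ∀ x : ℝ, 0 < x → ∀ r : ℂ, r ≠ 0 → HasDerivAt (fun y : ℝ => (y:ℂ)^r) (r * (x:ℂ)^(r-1)) x := by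
    intro x hx r hr
    exact hasDerivAt_ofReal_cpow_const hx.ne' hr
  have hmv1 : ∀ x ∈ Set.Icc (n:ℝ) (n+1), ‖(x:ℂ)^(-s) - ((n:ℝ):ℂ)^(-s)‖ ≤ ‖s‖ / (n:ℝ)^2 * (x - n) := by
    intro x hx
    have := Convex.norm_image_sub_le_of_norm_hasDerivWithin_le (f := fun y : ℝ => (y:ℂ)^(-s))
      (f' := fun y => -s * (y:ℂ)^(-s-1)) (s := Set.Icc (n:ℝ) (n+1)) (C := ‖s‖ / (n:ℝ)^2) (x := n) (y := x)
      (fun y hy => (hder y (by linarith [hy.1]) (-s) (neg_ne_zero.2 hs0)).hasDerivWithinAt)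
      (fun y hy => by
        have hy0 : 0 < y := by linarith [hy.1]
        rw [norm_mul, norm_neg, Complex.norm_cpow_eq_rpow_re_of_pos hy0]
        rw [div_eq_mul_inv]
        apply mul_le_mul_of_nonneg_left _ (norm_nonneg _)
        simp only [Complex.sub_re, Complex.neg_re, Complex.one_re]
        calc y^(-s.re-1) ≤ (n:ℝ)^(-s.re-1) := Real.rpow_le_rpow_of_nonpos (by linarith) hy.1 (by linarith)
          _ ≤ (n:ℝ)^(-2:ℝ) := Real.rpow_le_rpow_of_exponent_le hn1 (by linarith)
          _ = ((n:ℝ)^2)⁻¹ := by rw [Real.rpow_neg (by linarith)]; norm_num)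
      (convex_Icc _ _) ⟨le_rfl, by linarith⟩ hx
    rwa [Real.norm_of_nonneg (by linarith [hx.1])] at this
  have := Convex.norm_image_sub_le_of_norm_hasDerivWithin_le
    (f := fun y : ℝ => (y:ℂ) * (n:ℂ)^(-s) + (y:ℂ)^(1-s) / (s-1))
      (f' := fun y => 1 * (n:ℂ)^(-s) + ((1-s) * (y:ℂ)^(1-s-1)) / (s-1)) (s := Set.Icc (n:ℝ) (n+1)) (C := ‖s‖ / (n:ℝ)^2)
      (x := (n:ℝ)) (y := ((n:ℝ)+1))
      (fun y hy => by
        have h1 : HasDerivAt (fun y : ℝ => (y:ℂ)) 1 y := Complex.ofRealCLM.hasDerivAt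
        exact ((h1.mul_const _).add ((hder y (by linarith [hy.1]) (1-s) (by
          intro h; apply hs1'; linear_combination -h)).div_const _)).hasDerivWithinAt)
      (fun y hy => by
        have e : 1 * (n:ℂ)^(-s) + ((1-s) * (y:ℂ)^(1-s-1)) / (s-1) = -((y:ℂ)^(-s) - ((n:ℝ):ℂ)^(-s)) := by
          rw [show 1 - s - 1 = -s by ring]; push_cast; field_simp; ring
        rw [e, norm_neg]
        refine (hmv1 y hy).trans ?_
        have : 0 ≤ ‖s‖ / (n:ℝ)^2 := by positivity
        nlinarith [hy.2])
      (convex_Icc _ _) ⟨le_rfl, by linarith⟩ ⟨by linarith, le_rfl⟩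
  simp only [add_sub_cancel_left, norm_one, mul_one] at this
  refine le_trans (le_of_eq ?_) this
  congr 1
  push_cast; ring

lemma sum_inv_sq (X m : ℕ) (hX : 1 ≤ X) :
    ∑ n ∈ Finset.Ico X (X+m), 1 / (n:ℝ)^2 ≤ 2 / (X:ℝ) - 2 / ((X:ℝ) + m) := by
  have hX1 : (1:ℝ) ≤ X := by exact_mod_cast hX
  induction m with
  | zero => simp
  | succ m ih =>
    rw [← add_assoc, Finset.sum_Ico_succ_top (by omega)]
    push_cast
    have hm : (0:ℝ) ≤ m := by positivity
    have h1 : 1 / ((X:ℝ)+m)^2 ≤ 2 / ((X:ℝ)+m) - 2 / ((X:ℝ)+(m+1)) := by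
      rw [div_sub_div _ _ (by positivity) (by positivity), div_le_div_iff₀ (by positivity) (by positivity)]
      have : 1 ≤ (X:ℝ)+m := by linarith
      nlinarith [mul_nonneg (show 0 ≤ (X:ℝ)+m by linarith) (show 0 ≤ (X:ℝ)+m - 1 by linarith)]
    linarith

lemma norm_cpow_le_one (n : ℕ) (hn : 1 ≤ n) (s : ℂ) (hs : 1 ≤ s.re) : ‖(n:ℂ)^(1-s)‖ ≤ 1 := by
  have := norm_cpow_nat n hn (s - 1)
  rw [neg_sub] at this
  rw [this]
  apply Real.rpow_le_one_of_one_le_of_nonpos (by exact_mod_cast hn)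
  simp; linarith

lemma tail_bound (s : ℂ) (hs : 1 ≤ s.re) (hs1 : s ≠ 1) (X Y : ℕ) (hX : 1 ≤ X) (hXY : X ≤ Y) :
    ‖∑ n ∈ Finset.Ico X Y, (n:ℂ)^(-s)‖ ≤ 2 / ‖s - 1‖ + 2 * ‖s‖ / X := by
  have hX1 : (1:ℝ) ≤ X := by exact_mod_cast hX
  have hs1' : s - 1 ≠ 0 := sub_ne_zero.2 hs1
  have e : ∑ n ∈ Finset.Ico X Y, (n:ℂ)^(-s) =
      ∑ n ∈ Finset.Ico X Y, ((n:ℂ)^(-s) - ((n:ℂ)^(1-s) - ((n+1:ℕ):ℂ)^(1-s)) / (s-1)) +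
      ((X:ℂ)^(1-s) - (Y:ℂ)^(1-s)) / (s-1) := by
    have : ∑ n ∈ Finset.Ico X Y, ((n:ℂ)^(1-s) - ((n+1:ℕ):ℂ)^(1-s)) = (X:ℂ)^(1-s) - (Y:ℂ)^(1-s) := by
      have h := Finset.sum_Ico_sub (fun n : ℕ => (n:ℂ)^(1-s)) hXY
      rw [← neg_sub ((Y:ℂ)^(1-s)), ← h, ← Finset.sum_neg_distrib]
      exact Finset.sum_congr rfl (fun n _ => by ring)
    rw [← this, Finset.sum_div, ← Finset.sum_add_distrib]
    exact Finset.sum_congr rfl (fun n _ => by ring)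
  rw [e]
  refine (norm_add_le _ _).trans ?_
  have h1 : ‖∑ n ∈ Finset.Ico X Y, ((n:ℂ)^(-s) - ((n:ℂ)^(1-s) - ((n+1:ℕ):ℂ)^(1-s)) / (s-1))‖ ≤ 2 * ‖s‖ / X := by
    refine (norm_sum_le _ _).trans ?_
    refine (Finset.sum_le_sum (fun n hn => step_bound n (by rw [Finset.mem_Ico] at hn; omega) s hs hs1)).trans ?_
    obtain ⟨m, rfl⟩ := Nat.exists_eq_add_of_le hXY
    have := sum_inv_sq X m hX
    have e2 : ∑ n ∈ Finset.Ico X (X+m), ‖s‖ / (n:ℝ)^2 = ‖s‖ * ∑ n ∈ Finset.Ico X (X+m), 1 / (n:ℝ)^2 := by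
      rw [Finset.mul_sum]; exact Finset.sum_congr rfl (fun n _ => by ring)
    rw [e2, show 2 * ‖s‖ / X = ‖s‖ * (2 / X) by ring]
    apply mul_le_mul_of_nonneg_left _ (norm_nonneg _)
    have : 0 ≤ 2 / ((X:ℝ) + m) := by positivity
    linarith
  have h2 : ‖((X:ℂ)^(1-s) - (Y:ℂ)^(1-s)) / (s-1)‖ ≤ 2 / ‖s - 1‖ := by
    rw [norm_div]
    apply div_le_div_of_nonneg_right _ (norm_nonneg _)
    refine (norm_sub_le _ _).trans ?_
    linarith [norm_cpow_le_one X hX s hs, norm_cpow_le_one Y (by omega) s hs]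
  linarith

lemma zeta_sub_bound (s : ℂ) (hs : 1 < s.re) (X : ℕ) (hX : 1 ≤ X) :
    ‖riemannZeta s - ∑ n ∈ Finset.Ico 1 X, (n:ℂ)^(-s)‖ ≤ 2 / ‖s - 1‖ + 2 * ‖s‖ / X := by
  have hs1 : s ≠ 1 := by rintro rfl; simp at hs
  have hs0 : s ≠ 0 := by rintro rfl; simp at hs; linarith
  have hsum : Summable (fun n : ℕ => (n:ℂ)^(-s)) := by
    have := Complex.summable_one_div_nat_cpow.2 hs
    simpa [Complex.cpow_neg] using this
  have hz : riemannZeta s = ∑' n : ℕ, (n:ℂ)^(-s) := by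
    rw [zeta_eq_tsum_one_div_nat_cpow hs]
    simp [Complex.cpow_neg]
  have ht := hsum.hasSum.tendsto_sum_nat
  rw [← hz] at ht
  have ht2 := (ht.sub_const (∑ n ∈ Finset.Ico 1 X, (n:ℂ)^(-s))).norm
  apply le_of_tendsto ht2
  filter_upwards [Filter.eventually_ge_atTop X] with Y hY
  have : ∑ n ∈ Finset.range Y, (n:ℂ)^(-s) - ∑ n ∈ Finset.Ico 1 X, (n:ℂ)^(-s) = ∑ n ∈ Finset.Ico X Y, (n:ℂ)^(-s) := by
    rw [Finset.range_eq_Ico, ← Finset.sum_Ico_consecutive _ (by omega : 0 ≤ 1) (by omega : 1 ≤ Y),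
      ← Finset.sum_Ico_consecutive _ hX hY]
    simp [Complex.zero_cpow (neg_ne_zero.2 hs0)]
  rw [this]
  exact tail_bound s hs.le hs1 X Y hX hY

lemma zeta_approx (s : ℂ) (τ : ℝ) (hs : 1 < s.re) (hs2 : s.re ≤ 2) (ht : s.im = 2 * Real.pi * τ) (M : ℕ) (hτ : 1 ≤ τ)
    (hM : 1 ≤ M) (h : τ ≤ 4 * (M:ℝ)^2) (K : ℕ) (hK : s.im ^ 2 ≤ 2^K) :
    ‖riemannZeta s - ∑ n ∈ Finset.Ico 1 M, (n:ℂ)^(-s)‖ ≤ K * (200 * τ^(-(1/16):ℝ)) + 8 / s.im := by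
  have h1 := zeta_sub_bound s hs (2^K*M) (by have : 0 < 2^K*M := by positivity
                                             omega)
  have h2 := dir_dyadic s τ hs.le ht M hτ hM h K
  have hle : M ≤ 2^K*M := Nat.le_mul_of_pos_left _ (by positivity)
  rw [← Finset.sum_Ico_consecutive _ hM hle] at h1
  have h3 : riemannZeta s - ∑ n ∈ Finset.Ico 1 M, (n:ℂ)^(-s) =
      (riemannZeta s - (∑ n ∈ Finset.Ico 1 M, (n:ℂ)^(-s) + ∑ n ∈ Finset.Ico M (2^K*M), (n:ℂ)^(-s))) +
      ∑ n ∈ Finset.Ico M (2^K*M), (n:ℂ)^(-s) := by ring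
  rw [h3]
  refine (norm_add_le _ _).trans ?_
  have ht2 : 2 ≤ s.im := by
    rw [ht]; nlinarith [Real.pi_gt_three]
  have h4 : 2 / ‖s - 1‖ ≤ 2 / s.im := by
    apply div_le_div_of_nonneg_left (by norm_num) (by linarith)
    have := Complex.abs_im_le_norm (s - 1)
    simp at this
    exact (le_abs_self _).trans this
  have h5 : 2 * ‖s‖ / ((2^K*M : ℕ) : ℝ) ≤ 6 / s.im := by
    have hn : ‖s‖ ≤ 2 * s.im := by
      have := Complex.norm_le_abs_re_add_abs_im s
      rw [abs_of_pos (by linarith), abs_of_pos (by linarith)] at this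
      linarith
    have hX : s.im^2 ≤ ((2^K*M : ℕ) : ℝ) := by
      refine hK.trans ?_
      push_cast
      have : (1:ℝ) ≤ M := by exact_mod_cast hM
      have : (0:ℝ) < 2^K := by positivity
      nlinarith
    rw [div_le_div_iff₀ (by nlinarith) (by linarith)]
    nlinarith
  have : 8 / s.im = 2 / s.im + 6 / s.im := by ring
  linarith

lemma zeta341 {x : ℝ} (hx : 0 < x) (y : ℝ) :
    1 ≤ ‖riemannZeta (1 + x)‖^3 * ‖riemannZeta (1 + x + Complex.I * y)‖^4 *
      ‖riemannZeta (1 + x + 2 * Complex.I * y)‖ := by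
  have h := DirichletCharacter.norm_LFunction_product_ge_one (1 : DirichletCharacter ℂ 1) hx y
  rw [DirichletCharacter.LFunctionTrivChar] at h
  simp only [DirichletCharacter.LFunction_modOne_eq, norm_mul, norm_pow] at h
  exact h

lemma zeta_real_bound {x : ℝ} (hx : 0 < x) (hx1 : x ≤ 1) : ‖riemannZeta (1 + x)‖ ≤ 8 / x := by
  have h := zeta_sub_bound (1 + x) (by simp [hx]) 1 le_rfl
  have h1 : ‖(x:ℂ)‖ = x := by simp [abs_of_pos hx]
  have h2 : ‖(1 + x:ℂ)‖ ≤ 2 := by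
    refine (norm_add_le _ _).trans ?_
    rw [h1, norm_one]; linarith
  simp only [Finset.Ico_self, Finset.sum_empty, sub_zero, add_sub_cancel_left, h1, Nat.cast_one, div_one] at h
  have h3 : 4 ≤ 4 / x := by rw [le_div_iff₀ hx]; linarith
  have h4 : 8 / x = 2 / x + 4 / x + 2 / x := by ring
  have h5 : 0 < 2 / x := by positivity
  linarith

lemma sum_inv_log (N : ℕ) (t : ℝ) (hN : (N:ℝ) ≤ t) (ht : 1 ≤ t) :
    ∑ n ∈ Finset.Ico 1 (N+1), 1 / (n:ℝ) ≤ 1 + Real.log t := by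
  have h1 : ∑ n ∈ Finset.Ico 1 (N+1), 1 / (n:ℝ) = ((harmonic N : ℚ) : ℝ) := by
    rw [harmonic_eq_sum_Icc]
    push_cast
    have : Finset.Ico 1 (N+1) = Finset.Icc 1 N := by ext; simp
    rw [this]
    simp
  rw [h1]
  refine (harmonic_le_one_add_log N).trans ?_
  rcases Nat.eq_zero_or_pos N with h | h
  · subst h; simp; exact Real.log_nonneg ht
  · have : Real.log N ≤ Real.log t := Real.log_le_log (by exact_mod_cast h) hN
    linarith

lemma norm_cpow_le_inv (n : ℕ) (hn : 1 ≤ n) (s : ℂ) (hs : 1 ≤ s.re) : ‖(n:ℂ)^(-s)‖ ≤ 1 / (n:ℝ) := by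
  rw [norm_cpow_nat n hn]
  have h1 : (1:ℝ) ≤ n := by exact_mod_cast hn
  rw [one_div, ← Real.rpow_neg_one]
  exact Real.rpow_le_rpow_of_exponent_le h1 (by linarith)

lemma zeta_upper {x y : ℝ} (hx : 0 < x) (hx1 : x ≤ 1) (hy : 1 ≤ y) :
    ‖riemannZeta (1 + x + 2 * Complex.I * y)‖ ≤ 10 * (1 + Real.log y) := by
  set s : ℂ := 1 + x + 2 * Complex.I * y with hs
  have hre : s.re = 1 + x := by simp [hs]
  have him : s.im = 2 * y := by simp [hs]
  set N := ⌊2 * y⌋₊ with hN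
  have hN1 : (N:ℝ) ≤ 2 * y := Nat.floor_le (by linarith)
  have hN2 : 2 * y < N + 1 := Nat.lt_floor_add_one _
  have h := zeta_sub_bound s (by linarith) (N+1) (by omega)
  have hsum : ‖∑ n ∈ Finset.Ico 1 (N+1), (n:ℂ)^(-s)‖ ≤ 1 + Real.log (2 * y) := by
    refine (norm_sum_le _ _).trans (le_trans (Finset.sum_le_sum fun n hn => ?_) (sum_inv_log N (2*y) hN1 (by linarith)))
    exact norm_cpow_le_inv n (Finset.mem_Ico.1 hn).1 s (by linarith)
  have h1 : 2 ≤ ‖s - 1‖ := by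
    have := Complex.abs_im_le_norm (s - 1)
    have h2 : (s-1).im = 2 * y := by simp [him]
    rw [h2, abs_of_pos (by linarith)] at this
    linarith
  have h2 : 2 / ‖s - 1‖ ≤ 1 := by rw [div_le_one (by linarith)]; exact h1
  have h3 : ‖s‖ ≤ 2 + 2 * y := by
    have := Complex.norm_le_abs_re_add_abs_im s
    rw [hre, him, abs_of_pos (by linarith), abs_of_pos (by linarith)] at this
    linarith
  have h4 : 2 * ‖s‖ / ((N+1:ℕ):ℝ) ≤ 4 := by
    push_cast
    rw [div_le_iff₀ (by positivity)]
    linarith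
  have h5 : Real.log (2 * y) ≤ 1 + Real.log y := by
    rw [Real.log_mul (by norm_num) (by linarith)]
    have := Real.log_two_lt_d9
    linarith
  have h6 : 0 ≤ Real.log y := Real.log_nonneg hy
  have h7 : ‖riemannZeta s‖ ≤ ‖riemannZeta s - ∑ n ∈ Finset.Ico 1 (N+1), (n:ℂ)^(-s)‖ + ‖∑ n ∈ Finset.Ico 1 (N+1), (n:ℂ)^(-s)‖ := by
    have := norm_add_le (riemannZeta s - ∑ n ∈ Finset.Ico 1 (N+1), (n:ℂ)^(-s)) (∑ n ∈ Finset.Ico 1 (N+1), (n:ℂ)^(-s))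
    simpa using this
  linarith

lemma zeta_lower {x y η : ℝ} (hη : 0 < η) (hx : η ≤ x) (hx1 : x ≤ 1) (hy : 1 ≤ y) :
    1 ≤ (8 / η)^3 * ‖riemannZeta (1 + x + Complex.I * y)‖^4 * (10 * (1 + Real.log y)) := by
  have hx0 : 0 < x := by linarith
  refine (zeta341 hx0 y).trans ?_
  have h6 : 0 ≤ Real.log y := Real.log_nonneg hy
  have h1 : ‖riemannZeta (1 + x)‖ ≤ 8 / η := (zeta_real_bound hx0 hx1).trans (by gcongr)
  have h2 := zeta_upper hx0 hx1 hy
  gcongr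

lemma dir_diff (s : ℂ) (hs : 1 ≤ s.re) (δ t : ℝ) (hδ : 0 ≤ δ) (N : ℕ) (hN : (N:ℝ) ≤ t) (ht : 1 ≤ t) :
    ‖∑ n ∈ Finset.Ico 1 (N+1), (n:ℂ)^(-s) - ∑ n ∈ Finset.Ico 1 (N+1), (n:ℂ)^(-(s+δ))‖ ≤ δ * (1 + Real.log t)^2 := by
  rw [← Finset.sum_sub_distrib]
  have hl : 0 ≤ Real.log t := Real.log_nonneg ht
  have : δ * (1 + Real.log t)^2 = (δ * (1 + Real.log t)) * (1 + Real.log t) := by ring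
  rw [this]
  refine (norm_sum_le _ _).trans (le_trans ?_ (mul_le_mul_of_nonneg_left (sum_inv_log N t hN ht) (by positivity)))
  rw [Finset.mul_sum]
  refine Finset.sum_le_sum fun n hn => ?_
  obtain ⟨hn1, hn2⟩ := Finset.mem_Ico.1 hn
  have hn0 : (0:ℝ) < n := by exact_mod_cast hn1
  have hnC : (n:ℂ) ≠ 0 := by exact_mod_cast hn0.ne'
  have e : (n:ℂ)^(-s) - (n:ℂ)^(-(s+δ)) = (n:ℂ)^(-s) * ((1 - (n:ℝ)^(-δ) : ℝ) : ℂ) := by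
    rw [neg_add, Complex.cpow_add _ _ hnC]
    push_cast
    rw [Complex.ofReal_cpow hn0.le]
    push_cast; ring
  rw [e, norm_mul, mul_comm]
  have h1 := norm_cpow_le_inv n hn1 s hs
  have h2 : 1 - (n:ℝ)^(-δ) ≤ δ * Real.log n := by
    rw [Real.rpow_def_of_pos hn0]
    have := Real.add_one_le_exp (Real.log n * (-δ))
    linarith
  have h3 : 0 ≤ 1 - (n:ℝ)^(-δ) := by
    have := Real.rpow_le_one_of_one_le_of_nonpos (x := n) (z := -δ) (by exact_mod_cast hn1) (by linarith)
    linarith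
  have h4 : Real.log n ≤ Real.log t := Real.log_le_log hn0 (le_trans (by exact_mod_cast Nat.lt_succ_iff.1 hn2) hN)
  have h5 : ‖((1 - (n:ℝ)^(-δ) : ℝ) : ℂ)‖ ≤ δ * (1 + Real.log t) := by
    rw [Complex.norm_real, Real.norm_eq_abs, abs_of_nonneg h3]
    refine h2.trans ?_
    gcongr; linarith
  gcongr

lemma ev_log (C : ℝ) : ∃ t0 : ℝ, 8 ≤ t0 ∧ ∀ t, t0 ≤ t → C * (t^(-(1/16):ℝ) * (1 + Real.log t)^9) < 1 := by
  have h1 : Filter.Tendsto (fun t : ℝ => C * (t^(-(1/16):ℝ) * (1 + Real.log t)^9)) Filter.atTop (nhds (C * 0)) := by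
    refine Filter.Tendsto.const_mul _ ?_
    have h2 : Filter.Tendsto (fun t : ℝ => (t^(-(1/144):ℝ) * (1 + Real.log t))^9) Filter.atTop (nhds (0^9)) := by
      refine Filter.Tendsto.pow ?_ 9
      have h3 := (isLittleO_log_rpow_atTop (r := 1/144) (by norm_num)).tendsto_div_nhds_zero
      have h4 := tendsto_rpow_neg_atTop (y := 1/144) (by norm_num)
      have h5 := h4.add h3
      rw [add_zero] at h5
      refine h5.congr' ?_
      filter_upwards [Filter.eventually_gt_atTop 0] with t ht
      rw [Real.rpow_neg ht.le]; ring
    rw [zero_pow (by norm_num)] at h2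
    refine h2.congr' ?_
    filter_upwards [Filter.eventually_gt_atTop 0] with t ht
    rw [mul_pow, ← Real.rpow_natCast, ← Real.rpow_mul ht.le]
    norm_num
  rw [mul_zero] at h1
  obtain ⟨t0, h⟩ := Filter.eventually_atTop.1 ((h1.eventually (gt_mem_nhds one_pos)))
  exact ⟨max 8 t0, le_max_left _ _, fun t ht => h t (le_trans (le_max_right _ _) ht)⟩

set_option maxHeartbeats 1000000 in
lemma dir_lower_mid (C3 : ℝ) (hC : 0 ≤ C3) : ∃ t0 : ℝ, 8 ≤ t0 ∧ ∀ s : ℂ, 1 ≤ s.re → s.re ≤ 2 → t0 ≤ s.im →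
    C3 / Real.sqrt s.im < ‖∑ n ∈ Finset.Ico 1 (⌊Real.sqrt (s.im / (2 * Real.pi))⌋₊ + 1), (n:ℂ)^(-s)‖ := by
  set C := C3 + 1 + 1600 + 8 with hCdef
  obtain ⟨t0, ht8, h⟩ := ev_log (5120 * C^4)
  refine ⟨t0, ht8, fun s hs1 hs2 hst => ?_⟩
  by_contra hcon
  push Not at hcon
  set t := s.im with ht
  have ht8 : 8 ≤ t := ht8.trans hst
  have hπ := Real.pi_gt_three
  have hπ2 := Real.pi_lt_four
  set τ := t / (2 * Real.pi) with hτ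
  have hτt : t = 2 * Real.pi * τ := by rw [hτ]; field_simp
  have hτ1 : 1 ≤ τ := by
    rw [hτ, le_div_iff₀ (by positivity)]
    have := Real.pi_lt_d2
    linarith
  have hτt' : τ ≤ t := by rw [hτt]; nlinarith
  set N := ⌊Real.sqrt τ⌋₊ with hN
  have hN1 : (N:ℝ) ≤ Real.sqrt τ := Nat.floor_le (Real.sqrt_nonneg _)
  have hN2 : Real.sqrt τ < N + 1 := Nat.lt_floor_add_one _
  have hsq : Real.sqrt τ ^ 2 = τ := Real.sq_sqrt (by linarith)
  have hNt : (N:ℝ) ≤ t := by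
    have : 0 ≤ Real.sqrt τ := Real.sqrt_nonneg _
    have : 1 ≤ Real.sqrt τ := Real.one_le_sqrt.2 hτ1
    nlinarith
  set η := t^(-(1/16):ℝ) with hη
  have hη0 : 0 < η := Real.rpow_pos_of_pos (by linarith) _
  have hη1 : η ≤ 1 := Real.rpow_le_one_of_one_le_of_nonpos (by linarith) (by norm_num)
  set ℓ := 1 + Real.log t with hℓ
  have hℓ1 : 1 ≤ ℓ := by have := Real.log_nonneg (show (1:ℝ) ≤ t by linarith); linarith
  -- shift
  obtain ⟨δ, hδ0, hδη, hx1, hx2⟩ : ∃ δ : ℝ, 0 ≤ δ ∧ δ ≤ η ∧ η ≤ s.re + δ - 1 ∧ s.re + δ - 1 ≤ 1 := by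
    rcases le_total (1 + η) s.re with h | h
    · exact ⟨0, le_rfl, hη0.le, by linarith, by linarith⟩
    · exact ⟨1 + η - s.re, by linarith, by linarith, by linarith, by linarith⟩
  set x := s.re + δ - 1 with hx
  have hsx : s + δ = 1 + x + Complex.I * t := by
    apply Complex.ext <;> simp [hx, ht]
  have hlow := zeta_lower hη0 hx1 hx2 (show 1 ≤ t by linarith)
  rw [← hsx] at hlow
  have hdiff := dir_diff s hs1 δ t hδ0 N hNt (by linarith)
  set K := ⌈2 * Real.log t / Real.log 2⌉₊ with hK
  have hlog2 := Real.log_two_gt_d9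
  have hlogt : 0 ≤ Real.log t := by linarith
  have hK1 : t^2 ≤ 2^K := by
    have h1 : 2 * Real.log t / Real.log 2 ≤ K := Nat.le_ceil _
    rw [div_le_iff₀ (by linarith)] at h1
    rw [← Real.log_le_log_iff (by positivity) (by positivity), Real.log_pow, Real.log_pow]
    exact_mod_cast h1
  have hK2 : (K:ℝ) ≤ 4 * ℓ := by
    have h1 := Nat.ceil_lt_add_one (a := 2 * Real.log t / Real.log 2) (by positivity)
    have h2 : 2 * Real.log t / Real.log 2 ≤ 4 * Real.log t := by
      rw [div_le_iff₀ (by linarith)]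
      nlinarith
    rw [← hK] at h1
    linarith
  have happ := zeta_approx (s + δ) τ (by simp; linarith) (by simp; linarith) (by simp [← ht, hτt]) (N+1) hτ1 (by omega)
    (by push_cast; nlinarith [Real.sqrt_nonneg τ]) K (by simpa [← ht] using hK1)
  have him : (s + δ : ℂ).im = t := by simp [ht]
  rw [him] at happ
  have hτη : τ^(-(1/16):ℝ) ≤ 2 * η := by
    rw [hτ, Real.div_rpow (by linarith) (by positivity), ← hη, div_le_iff₀ (by positivity)]
    have h1 : (1/2:ℝ) ≤ (2 * Real.pi)^(-(1/16):ℝ) := by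
      have h2 : ((2:ℝ)^(16:ℝ))^(-(1/16):ℝ) ≤ (2 * Real.pi)^(-(1/16):ℝ) :=
        Real.rpow_le_rpow_of_nonpos (by positivity) (by norm_num; linarith) (by norm_num)
      rw [← Real.rpow_mul (by norm_num)] at h2
      norm_num at h2 ⊢
      exact h2
    nlinarith
  have ht_inv : 8 / t ≤ 8 * η := by
    have : t⁻¹ ≤ η := by
      rw [← Real.rpow_neg_one]
      exact Real.rpow_le_rpow_of_exponent_le (by linarith) (by norm_num)
    rw [div_eq_mul_inv]; linarith
  have hsqt : C3 / Real.sqrt t ≤ C3 * η := by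
    have : (Real.sqrt t)⁻¹ ≤ η := by
      rw [Real.sqrt_eq_rpow, ← Real.rpow_neg (by linarith)]
      exact Real.rpow_le_rpow_of_exponent_le (by linarith) (by norm_num)
    rw [div_eq_mul_inv]
    gcongr
  have hZ : ‖riemannZeta (s + δ)‖ ≤ C * (η * ℓ^2) := by
    set Z := riemannZeta (s + δ)
    set D1 := ∑ n ∈ Finset.Ico 1 (N+1), (n:ℂ)^(-s)
    set D2 := ∑ n ∈ Finset.Ico 1 (N+1), (n:ℂ)^(-(s+δ))
    have e : Z = (Z - D2) + (-(D1 - D2)) + D1 := by ring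
    have h1 : ‖Z‖ ≤ ‖Z - D2‖ + ‖D1 - D2‖ + ‖D1‖ := by
      conv_lhs => rw [e]
      refine (norm_add₃_le).trans ?_
      rw [norm_neg]
    have h2 : K * (200 * τ^(-(1/16):ℝ)) ≤ (4 * ℓ) * (200 * (2 * η)) := by gcongr
    have h3 : δ * ℓ^2 ≤ η * ℓ^2 := by gcongr
    have h4 : η ≤ η * ℓ^2 := le_mul_of_one_le_right hη0.le (by nlinarith)
    have h5 : η * ℓ ≤ η * ℓ^2 := mul_le_mul_of_nonneg_left (by nlinarith) hη0.le
    have h6 : C3 * η ≤ C3 * (η * ℓ^2) := by gcongr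
    rw [hCdef]
    nlinarith
  have hfin : (8 / η)^3 * ‖riemannZeta (s + δ)‖^4 * (10 * ℓ) ≤ 5120 * C^4 * (η * ℓ^9) := by
    calc _ ≤ (8 / η)^3 * (C * (η * ℓ^2))^4 * (10 * ℓ) := by gcongr
      _ = _ := by field_simp; ring
  have := h t hst
  linarith

lemma dir_lower_big (s : ℂ) (hs : 2 ≤ s.re) (N : ℕ) (hN : 1 ≤ N) :
    1/4 ≤ ‖∑ n ∈ Finset.Ico 1 (N + 1), (n:ℂ)^(-s)‖ := by
  rw [Finset.sum_eq_sum_Ico_succ_bot (by omega)]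
  have hb : ∀ n ∈ Finset.Ico (1+1) (N+1), ‖(n:ℂ)^(-s)‖ ≤ 1/(n:ℝ)^2 := by
    intro n hn
    have hn1 := (Finset.mem_Ico.1 hn).1
    rw [norm_cpow_nat n (by omega), one_div, ← Real.rpow_natCast, ← Real.rpow_neg (by positivity)]
    exact Real.rpow_le_rpow_of_exponent_le (by exact_mod_cast (by omega : 1 ≤ n)) (by push_cast; linarith)
  have ht : ∀ m : ℕ, ∑ n ∈ Finset.Ico 2 (2 + m), 1/(n:ℝ)^2 ≤ 2/3 - 1/(m+3/2:ℝ) := by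
    intro m
    induction m with
    | zero => norm_num
    | succ m ih =>
      rw [← add_assoc, Finset.sum_Ico_succ_top (by omega)]
      have h : 1/((2 + m : ℕ):ℝ)^2 ≤ 1/(m+3/2:ℝ) - 1/(((m+1:ℕ):ℝ)+3/2) := by
        push_cast
        rw [div_sub_div _ _ (by positivity) (by positivity), div_le_div_iff₀ (by positivity) (by positivity)]
        nlinarith
      linarith
  obtain ⟨m, rfl⟩ : ∃ m, N = 1 + m := ⟨N - 1, by omega⟩
  have h1 := ht m
  have h2 : ‖∑ n ∈ Finset.Ico (1+1) (1 + m + 1), (n:ℂ)^(-s)‖ ≤ 2/3 := by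
    refine (norm_sum_le _ _).trans ((Finset.sum_le_sum hb).trans ?_)
    have e : 1 + m + 1 = 2 + m := by ring
    rw [e]
    have : 0 ≤ 1/(m+3/2:ℝ) := by positivity
    linarith
  have h3 := norm_sub_le_norm_add (((1:ℕ):ℂ)^(-s)) (∑ n ∈ Finset.Ico (1+1) (1 + m + 1), (n:ℂ)^(-s))
  have h4 : ‖((1:ℕ):ℂ)^(-s)‖ = 1 := by simp
  rw [h4] at h3
  exact le_trans (by linarith) h3

lemma dir_lower (C3 : ℝ) (hC : 0 ≤ C3) : ∃ t0 : ℝ, 8 ≤ t0 ∧ ∀ s : ℂ, 1 ≤ s.re → t0 ≤ s.im →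
    C3 / Real.sqrt s.im < ‖∑ n ∈ Finset.Ico 1 (⌊Real.sqrt (s.im / (2 * Real.pi))⌋₊ + 1), (n:ℂ)^(-s)‖ := by
  obtain ⟨t0, h8, h⟩ := dir_lower_mid C3 hC
  refine ⟨max t0 ((4 * C3 + 1)^2), h8.trans (le_max_left _ _), fun s hs hst => ?_⟩
  have h1 : t0 ≤ s.im := (le_max_left _ _).trans hst
  have h2 : (4 * C3 + 1)^2 ≤ s.im := (le_max_right _ _).trans hst
  rcases le_total s.re 2 with hs2 | hs2
  · exact h s hs hs2 h1
  · refine lt_of_lt_of_le ?_ (dir_lower_big s hs2 _ ?_)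
    · have h3 : 4 * C3 + 1 ≤ Real.sqrt s.im := Real.le_sqrt_of_sq_le h2
      rw [div_lt_iff₀ (by linarith)]
      linarith
    · rw [Nat.one_le_floor_iff, Real.one_le_sqrt, le_div_iff₀ (by positivity)]
      have := Real.pi_lt_d2
      linarith

noncomputable def W8 : ℂ := Complex.exp (Real.pi * Complex.I / 4)

lemma W8_eq : W8 = ((Real.sqrt 2 / 2 : ℝ) : ℂ) + ((Real.sqrt 2 / 2 : ℝ) : ℂ) * Complex.I := by
  have : (Real.pi * Complex.I / 4 : ℂ) = ((Real.pi / 4 : ℝ) : ℂ) * Complex.I := by push_cast; ring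
  rw [W8, this, Complex.exp_mul_I, ← Complex.ofReal_cos, ← Complex.ofReal_sin, Real.cos_pi_div_four, Real.sin_pi_div_four]

lemma W8_re : W8.re = Real.sqrt 2 / 2 := by rw [W8_eq]; simp
lemma W8_im : W8.im = Real.sqrt 2 / 2 := by rw [W8_eq]; simp

lemma W8_sq : W8^2 = Complex.I := by
  rw [W8, ← Complex.exp_nat_mul]
  have : ((2:ℕ) * (Real.pi * Complex.I / 4) : ℂ) = Real.pi / 2 * Complex.I := by push_cast; ring
  rw [this, Complex.exp_pi_div_two_mul_I]

lemma W8_norm : ‖W8‖ = 1 := by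
  have : (Real.pi * Complex.I / 4 : ℂ) = ((Real.pi / 4 : ℝ) : ℂ) * Complex.I := by push_cast; ring
  rw [W8, this, Complex.norm_exp_ofReal_mul_I]

lemma W8_ne : W8 ≠ 0 := Complex.exp_ne_zero _

lemma sqrt2_sq : Real.sqrt 2 * Real.sqrt 2 = 2 := Real.mul_self_sqrt (by norm_num)

lemma norm_gauss (c u : ℝ) :
    ‖Complex.exp (Real.pi * Complex.I * ((c:ℂ) - W8 * u)^2)‖ = Real.exp (Real.pi * (Real.sqrt 2 * c * u - u^2)) := by
  rw [Complex.norm_exp]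
  congr 1
  have e : Real.pi * Complex.I * ((c:ℂ) - W8 * u)^2 = Real.pi * Complex.I * ((c^2 : ℝ) - (2 * c * u : ℝ) * W8 + (u^2 : ℝ) * Complex.I) := by
    rw [← W8_sq]; push_cast; ring
  rw [e, W8_eq]
  simp [-Complex.ofReal_pow]
  ring

lemma norm_cos_lower (y : ℝ) : 1 ≤ ‖Complex.cos ((y:ℂ) + y * Complex.I)‖ := by
  rw [Complex.cos_eq]
  have e : (Complex.cos (((y:ℂ) + y * Complex.I).re) * Complex.cosh (((y:ℂ) + y * Complex.I).im) -
    Complex.sin (((y:ℂ) + y * Complex.I).re) * Complex.sinh (((y:ℂ) + y * Complex.I).im) * Complex.I) =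
    ((Real.cos y * Real.cosh y : ℝ):ℂ) + ((-(Real.sin y * Real.sinh y) : ℝ):ℂ) * Complex.I := by
    simp; ring
  rw [e, Complex.norm_add_mul_I, Real.one_le_sqrt]
  have h1 := Real.sin_sq_add_cos_sq y
  have h2 := Real.cosh_sq y
  have h3 : Real.sin y ^2 ≤ Real.sinh y ^2 := by
    have h4 : |Real.sin y| ≤ |Real.sinh y| := by
      have h5 : |Real.sin y| ≤ |y| := Real.abs_sin_le_abs
      have h6 : |y| ≤ |Real.sinh y| := by
        rw [Real.abs_sinh]
        exact Real.self_le_sinh_iff.2 (abs_nonneg y)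
      exact h5.trans h6
    exact sq_le_sq.2 h4
  have : (Real.cos y * Real.cosh y)^2 + (-(Real.sin y * Real.sinh y))^2 = Real.cos y^2 + Real.sinh y^2 := by
    have : (Real.cos y * Real.cosh y)^2 + (-(Real.sin y * Real.sinh y))^2 = Real.cos y^2 * Real.cosh y^2 + Real.sin y^2 * Real.sinh y^2 := by ring
    rw [this, h2]
    linear_combination (Real.sinh y^2) * h1
  rw [this]
  linarith

noncomputable def den (x : ℂ) : ℂ := Complex.exp (Real.pi * Complex.I * x) - Complex.exp (-(Real.pi * Complex.I * x))

lemma den_add_one (x : ℂ) : den (x + 1) = - den x := by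
  have h1 : Complex.exp (Real.pi * Complex.I * (x+1)) = - Complex.exp (Real.pi * Complex.I * x) := by
    rw [mul_add, mul_one, Complex.exp_add, Complex.exp_pi_mul_I]; ring
  rw [den, den, h1, Complex.exp_neg, h1, Complex.exp_neg, inv_neg]; ring

lemma den_add_nat (x : ℂ) (n : ℕ) : den (x + n) = (-1)^n * den x := by
  induction n with
  | zero => simp
  | succ n ih => push_cast; rw [← add_assoc, den_add_one, ih]; ring

lemma den_half (x : ℂ) : den (1/2 + x) = 2 * Complex.I * Complex.cos (Real.pi * x) := by
  have h1 : Complex.exp (Real.pi * Complex.I * (1/2 + x)) = Complex.I * Complex.exp (Real.pi * x * Complex.I) := by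
    rw [show Real.pi * Complex.I * (1/2 + x) = Real.pi / 2 * Complex.I + Real.pi * x * Complex.I by ring,
      Complex.exp_add, Complex.exp_pi_div_two_mul_I]
  rw [den, Complex.exp_neg, h1, mul_inv, ← Complex.exp_neg, Complex.inv_I, Complex.cos]
  rw [neg_mul_comm, neg_mul]
  ring_nf

lemma den_lower (n : ℕ) (u : ℝ) : 2 ≤ ‖den (((n + 1/2 : ℝ) : ℂ) - W8 * u)‖ := by
  have e : (((n + 1/2 : ℝ) : ℂ) - W8 * u) = (1/2 + (-(W8 * u))) + n := by push_cast; ring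
  rw [e, den_add_nat, den_half]
  have e2 : (Real.pi * (-(W8 * u)) : ℂ) = ((-(Real.pi * (Real.sqrt 2 / 2) * u) : ℝ):ℂ) + ((-(Real.pi * (Real.sqrt 2 / 2) * u) : ℝ):ℂ) * Complex.I := by
    rw [W8_eq]; push_cast; ring
  rw [e2]
  have := norm_cos_lower (-(Real.pi * (Real.sqrt 2 / 2) * u))
  simp only [norm_mul, norm_pow, norm_neg, norm_one, one_pow, Complex.norm_I, mul_one, one_mul]
  norm_num
  simpa using this

lemma den_sub_nat_half (n : ℕ) (hn : 1 ≤ n) (u : ℝ) : 2 ≤ ‖den (((n - 1/2 : ℝ) : ℂ) - W8 * u)‖ := by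
  have := den_lower (n-1) u
  have e : (((n-1:ℕ):ℝ) + 1/2) = (n:ℝ) - 1/2 := by rw [Nat.cast_sub hn]; push_cast; ring
  rwa [e] at this

lemma quad_pos (v : ℝ) : 1/2 ≤ 1 - Real.sqrt 2 * v + v^2 := by
  nlinarith [sq_nonneg (v - Real.sqrt 2 / 2), sqrt2_sq]

lemma slit (v : ℝ) : 1 - W8 * v ∈ Complex.slitPlane := by
  rw [Complex.mem_slitPlane_iff]
  simp [W8_re, W8_im]
  by_cases h : v = 0
  · left; simp [h]
  · right; exact h

lemma normSq_line (v : ℝ) : Complex.normSq (1 - W8 * v) = 1 - Real.sqrt 2 * v + v^2 := by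
  rw [Complex.normSq_apply]
  simp [W8_re, W8_im]
  linear_combination (v^2/2) * sqrt2_sq

noncomputable def AA (v : ℝ) : ℝ := Complex.arg (1 - W8 * v)

lemma AA_deriv (v : ℝ) : HasDerivAt AA (-(Real.sqrt 2 / 2) / (1 - Real.sqrt 2 * v + v^2)) v := by
  have h1 : HasDerivAt (fun v : ℝ => (1 - W8 * v : ℂ)) (-W8) v := by
    have := ((Complex.ofRealCLM.hasDerivAt (x := v)).const_mul W8).const_sub 1
    simpa using this
  have h2 := h1.clog_real (slit v)
  have h3 := (Complex.imCLM.hasFDerivAt.comp_hasDerivAt v h2)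
  have e : (Complex.imCLM ∘ fun t : ℝ => Complex.log (1 - W8 * t)) = AA := by
    ext t; simp [AA, Complex.log_im]
  rw [e] at h3
  refine h3.congr_deriv ?_
  rw [Complex.imCLM_apply, Complex.div_im, normSq_line]
  simp [W8_re, W8_im]
  ring

lemma AA_zero : AA 0 = 0 := by simp [AA]

lemma AA_abs (v : ℝ) : |AA v| ≤ Real.sqrt 2 * |v| := by
  have := Convex.norm_image_sub_le_of_norm_hasDerivWithin_le (f := AA) (f' := fun v => (-(Real.sqrt 2 / 2) / (1 - Real.sqrt 2 * v + v^2)))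
    (C := Real.sqrt 2) (s := Set.univ) (x := 0) (y := v) (fun x _ => (AA_deriv x).hasDerivWithinAt) (fun x _ => ?_) convex_univ trivial trivial
  · simpa [AA_zero] using this
  · have h := quad_pos x
    rw [Real.norm_eq_abs, abs_div, abs_neg, abs_of_nonneg (by positivity), abs_of_pos (by linarith), div_le_iff₀ (by linarith)]
    nlinarith [Real.sqrt_nonneg 2]

lemma AA_le (v : ℝ) : AA v ≤ -(Real.sqrt 2 / 2) * v + v^2/4 := by
  set φ : ℝ → ℝ := fun v => -(Real.sqrt 2 / 2) * v + v^2/4 - AA v with hφ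
  have hd : ∀ v, HasDerivAt φ (v * (((v - Real.sqrt 2)^2 + 1) / (2 * (1 - Real.sqrt 2 * v + v^2)))) v := by
    intro v
    have h1 : HasDerivAt (fun v : ℝ => -(Real.sqrt 2 / 2) * v + v^2/4) (-(Real.sqrt 2 / 2) * 1 + (2 * v^(2-1) * 1)/4) v := by
      have := ((hasDerivAt_id v).const_mul (-(Real.sqrt 2 / 2))).add (((hasDerivAt_id v).pow 2).div_const 4)
      exact this.congr_deriv (by simp)
    refine (h1.sub (AA_deriv v)).congr_deriv ?_
    have h := quad_pos v
    field_simp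
    ring_nf
  have hc : Continuous φ := continuous_iff_continuousAt.2 fun v => (hd v).continuousAt
  have h0 : φ 0 = 0 := by simp [hφ, AA_zero]
  have key : 0 ≤ φ v := by
    rcases le_total 0 v with hv | hv
    · have : MonotoneOn φ (Set.Ici 0) := by
        refine monotoneOn_of_deriv_nonneg (convex_Ici 0) hc.continuousOn (fun x _ => (hd x).differentiableAt.differentiableWithinAt) ?_
        intro x hx
        rw [interior_Ici, Set.mem_Ioi] at hx
        rw [(hd x).deriv]
        have := quad_pos x
        exact mul_nonneg hx.le (div_nonneg (by positivity) (by linarith))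
      have := this (Set.mem_Ici.2 le_rfl) (Set.mem_Ici.2 hv) hv
      linarith
    · have : AntitoneOn φ (Set.Iic 0) := by
        refine antitoneOn_of_deriv_nonpos (convex_Iic 0) hc.continuousOn (fun x _ => (hd x).differentiableAt.differentiableWithinAt) ?_
        intro x hx
        rw [interior_Iic, Set.mem_Iio] at hx
        rw [(hd x).deriv]
        have := quad_pos x
        exact mul_nonpos_of_nonpos_of_nonneg hx.le (div_nonneg (by positivity) (by linarith))
      have := this (Set.mem_Iic.2 hv) (Set.mem_Iic.2 le_rfl) hv
      linarith
  simp only [hφ] at key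
  linarith

noncomputable def KK (s x : ℂ) : ℂ := x ^ (-s) * Complex.exp (Real.pi * Complex.I * x ^ 2) / den x

lemma norm_line (v : ℝ) : Real.sqrt 2 / 2 ≤ ‖1 - W8 * v‖ := by
  rw [Complex.norm_def, normSq_line]
  refine Real.le_sqrt_of_sq_le ?_
  nlinarith [quad_pos v, sqrt2_sq]

lemma expo_bound (a τ u : ℝ) (ha : 0 < a) (h : |τ - a^2| ≤ 3/2 * a) :
    2 * Real.pi * τ * AA (u / a) + Real.pi * (Real.sqrt 2 * a * u - u^2) ≤ 100 - u^2 := by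
  have hπ := Real.pi_gt_d2
  have hπ2 := Real.pi_lt_d2
  set v := u / a with hv
  have hu : u = a * v := by rw [hv]; field_simp
  have h1 := AA_le v
  have h2 := AA_abs v
  have h3 : (τ - a^2) * AA v ≤ 3/2 * Real.sqrt 2 * |u| := by
    calc (τ - a^2) * AA v ≤ |(τ - a^2) * AA v| := le_abs_self _
      _ = |τ - a^2| * |AA v| := abs_mul _ _
      _ ≤ (3/2 * a) * (Real.sqrt 2 * |v|) := by gcongr
      _ = 3/2 * Real.sqrt 2 * |u| := by rw [hu, abs_mul, abs_of_pos ha]; ring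
  have h4 : a^2 * AA v ≤ a^2 * (-(Real.sqrt 2 / 2) * v + v^2/4) := by gcongr
  have h5 : a^2 * (-(Real.sqrt 2 / 2) * v + v^2/4) = -(Real.sqrt 2 / 2) * a * u + u^2/4 := by rw [hu]; ring
  have h6 : Real.sqrt 2 ≤ 1.5 := by
    rw [Real.sqrt_le_left (by norm_num)]; norm_num
  have h7 : τ * AA v ≤ -(Real.sqrt 2 / 2) * a * u + u^2/4 + 9/4 * |u| := by
    have : 3/2 * Real.sqrt 2 * |u| ≤ 9/4 * |u| := by
      have := abs_nonneg u
      nlinarith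
    nlinarith
  have h8 : 2 * Real.pi * (τ * AA v) ≤ 2 * Real.pi * (-(Real.sqrt 2 / 2) * a * u + u^2/4 + 9/4 * |u|) := by gcongr
  have h9 : Real.pi * (9/2 * |u| - u^2/2) ≤ 100 - u^2 := by
    have hs : u^2 = |u|^2 := (sq_abs u).symm
    rw [hs]
    have := abs_nonneg u
    have h10 : Real.pi * |u| ≤ 3.15 * |u| := by gcongr
    have h11 : 3.14 * |u|^2 ≤ Real.pi * |u|^2 := by gcongr
    nlinarith [sq_nonneg (|u| - 14.175 / 1.14)]
  nlinarith

lemma KK_bound (s : ℂ) (N : ℕ) (hs : 1 ≤ s.re) (hN : 1 ≤ N) (τ : ℝ) (ht : s.im = 2 * Real.pi * τ)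
    (h : |τ - (N + 1/2:ℝ)^2| ≤ 3/2 * (N + 1/2:ℝ)) (u : ℝ) :
    ‖KK s (((N + 1/2 : ℝ) : ℂ) - W8 * u)‖ ≤ (1 / (N + 1/2:ℝ)) * Real.exp (100 - u^2) := by
  set a : ℝ := N + 1/2 with ha
  have hN' : (1:ℝ) ≤ N := by exact_mod_cast hN
  have ha1 : 3/2 ≤ a := by rw [ha]; linarith
  have ha0 : 0 < a := by linarith
  have hx : ((a:ℂ) - W8 * u) = (a:ℂ) * (1 - W8 * (u / a : ℝ)) := by
    push_cast
    have : (a:ℂ) ≠ 0 := by exact_mod_cast ha0.ne'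
    field_simp
  have hnx : ‖((a:ℂ) - W8 * u)‖ ≥ a * (Real.sqrt 2 / 2) := by
    rw [hx, norm_mul, Complex.norm_real, Real.norm_eq_abs, abs_of_pos ha0]
    have := norm_line (u / a)
    gcongr
  have hs2 : 1.4 ≤ Real.sqrt 2 := Real.le_sqrt_of_sq_le (by norm_num)
  have hnx1 : 1 ≤ ‖((a:ℂ) - W8 * u)‖ := by nlinarith
  have hnx2 : a / 2 ≤ ‖((a:ℂ) - W8 * u)‖ := by nlinarith
  have hne : ((a:ℂ) - W8 * u) ≠ 0 := by
    intro h0; rw [h0, norm_zero] at hnx1; linarith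
  have harg : Complex.arg ((a:ℂ) - W8 * u) = AA (u / a) := by
    rw [hx, Complex.arg_real_mul _ ha0, AA]
  rw [KK, norm_div, norm_mul, norm_gauss, Complex.norm_cpow_of_ne_zero hne, harg]
  have h1 : ‖((a:ℂ) - W8 * u)‖ ^ (-s).re ≤ 2 / a := by
    calc ‖((a:ℂ) - W8 * u)‖ ^ (-s).re ≤ ‖((a:ℂ) - W8 * u)‖ ^ (-1:ℝ) := 
          Real.rpow_le_rpow_of_exponent_le hnx1 (by simp; linarith)
      _ = ‖((a:ℂ) - W8 * u)‖⁻¹ := Real.rpow_neg_one _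
      _ ≤ (a / 2)⁻¹ := by gcongr
      _ = 2 / a := by rw [inv_div]
  have h2 := den_lower N u
  rw [← ha] at h2
  have h3 : ‖((a:ℂ) - W8 * u)‖ ^ (-s).re / Real.exp (AA (u / a) * (-s).im) * Real.exp (Real.pi * (Real.sqrt 2 * a * u - u^2))
      = ‖((a:ℂ) - W8 * u)‖ ^ (-s).re * Real.exp (2 * Real.pi * τ * AA (u / a) + Real.pi * (Real.sqrt 2 * a * u - u^2)) := by
    rw [Real.exp_add, div_eq_mul_inv, ← Real.exp_neg, Complex.neg_im, ht]
    ring_nf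
  rw [h3, div_le_iff₀ (by linarith)]
  have h4 := expo_bound a τ u ha0 h
  calc _ ≤ (2 / a) * Real.exp (100 - u^2) := by gcongr
    _ = (1 / a * Real.exp (100 - u^2)) * 2 := by ring
    _ ≤ _ := by gcongr

lemma gauss_int (c : ℝ) : Integrable (fun u : ℝ => Real.exp (c - u^2)) := by
  have := (integrable_exp_neg_mul_sq (b := 1) one_pos).const_mul (Real.exp c)
  refine this.congr (Filter.Eventually.of_forall fun u => ?_)
  simp only
  rw [← Real.exp_add]; congr 1; ring

lemma remainder : ∃ C : ℝ, 0 ≤ C ∧ ∀ s : ℂ, 1 ≤ s.re → 8 ≤ s.im →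
    ‖∫ u : ℝ, KK s (((⌊Real.sqrt (s.im / (2 * Real.pi))⌋₊ + 1/2 : ℝ) : ℂ) - W8 * u)‖ ≤ C / Real.sqrt s.im := by
  refine ⟨6 * ∫ u : ℝ, Real.exp (100 - u^2), ?_, fun s hs hst => ?_⟩
  · have : 0 ≤ ∫ u : ℝ, Real.exp (100 - u^2) := integral_nonneg fun u => (Real.exp_pos _).le
    linarith
  set t := s.im with ht
  have hπ := Real.pi_gt_three
  have hπ2 := Real.pi_lt_d2
  set τ := t / (2 * Real.pi) with hτ
  have hτt : t = 2 * Real.pi * τ := by rw [hτ]; field_simp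
  have hτ1 : 1 ≤ τ := by
    rw [hτ, le_div_iff₀ (by positivity)]
    linarith
  set N := ⌊Real.sqrt τ⌋₊ with hN
  have hN1 : (N:ℝ) ≤ Real.sqrt τ := Nat.floor_le (Real.sqrt_nonneg _)
  have hN2 : Real.sqrt τ < N + 1 := Nat.lt_floor_add_one _
  have hN3 : 1 ≤ N := by rw [hN, Nat.one_le_floor_iff, Real.one_le_sqrt]; exact hτ1
  have hN3' : (1:ℝ) ≤ N := by exact_mod_cast hN3
  have hsq : Real.sqrt τ ^ 2 = τ := Real.sq_sqrt (by linarith)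
  have habs : |τ - (N + 1/2:ℝ)^2| ≤ 3/2 * (N + 1/2:ℝ) := by
    rw [abs_le]; constructor <;> nlinarith
  have hb := norm_integral_le_of_norm_le ((gauss_int 100).const_mul (1 / (N + 1/2:ℝ)))
    (Filter.Eventually.of_forall (KK_bound s N hs hN3 τ (ht ▸ hτt) habs))
  refine hb.trans ?_
  rw [integral_const_mul]
  have hI : 0 ≤ ∫ u : ℝ, Real.exp (100 - u^2) := integral_nonneg fun u => (Real.exp_pos _).le
  have h1 : Real.sqrt t ≤ 6 * (N + 1/2) := by
    rw [Real.sqrt_le_left (by linarith)]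
    rw [hτt]
    nlinarith
  have h2 : 1 / (N + 1/2:ℝ) ≤ 6 / Real.sqrt t := by
    rw [div_le_div_iff₀ (by linarith) (Real.sqrt_pos.2 (by linarith))]
    linarith
  calc _ ≤ (6 / Real.sqrt t) * ∫ u : ℝ, Real.exp (100 - u^2) := by gcongr
    _ = _ := by ring

lemma line_shift (G : ℂ → ℂ) (h C : ℝ) (hh : 0 < h) (hd : DifferentiableOn ℂ G {z | |z.im| ≤ h})
    (hB : ∀ u y : ℝ, |y| ≤ h → ‖G (u + y * Complex.I)‖ ≤ C * Real.exp (-u^2)) :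
    Integrable (fun u : ℝ => G (u + (-h : ℝ) * Complex.I)) ∧ Integrable (fun u : ℝ => G (u + (h : ℝ) * Complex.I)) ∧
    ∫ u : ℝ, G (u + (-h : ℝ) * Complex.I) = ∫ u : ℝ, G (u + (h : ℝ) * Complex.I) := by
  have hcont : ∀ y : ℝ, |y| ≤ h → Continuous (fun u : ℝ => G (u + y * Complex.I)) := by
    intro y hy
    refine hd.continuousOn.comp_continuous (by fun_prop) (fun u => ?_)
    simpa using hy
  have hg : Integrable (fun u : ℝ => C * Real.exp (-u^2)) := by
    have := (gauss_int 0).const_mul C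
    simpa using this
  have hInteg : ∀ y : ℝ, |y| ≤ h → Integrable (fun u : ℝ => G (u + y * Complex.I)) := fun y hy =>
    hg.mono' (hcont y hy).aestronglyMeasurable (Filter.Eventually.of_forall fun u => hB u y hy)
  have h1 : |(-h)| ≤ h := by rw [abs_neg, abs_of_pos hh]
  have h2 : |h| ≤ h := by rw [abs_of_pos hh]
  refine ⟨hInteg _ h1, hInteg _ h2, ?_⟩
  have t1 := intervalIntegral_tendsto_integral (hInteg _ h1) Filter.tendsto_neg_atTop_atBot Filter.tendsto_id
  have t2 := intervalIntegral_tendsto_integral (hInteg _ h2) Filter.tendsto_neg_atTop_atBot Filter.tendsto_id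
  have hrect : ∀ T : ℝ, (∫ x : ℝ in -T..T, G (x + (-h:ℝ) * Complex.I)) - (∫ x : ℝ in -T..T, G (x + (h:ℝ) * Complex.I)) =
      Complex.I • (∫ y : ℝ in (-h)..h, G ((-T:ℝ) + y * Complex.I)) - Complex.I • ∫ y : ℝ in (-h)..h, G ((T:ℝ) + y * Complex.I) := by
    intro T
    have := Complex.integral_boundary_rect_eq_zero_of_differentiableOn G ((-T:ℝ) + (-h:ℝ) * Complex.I) ((T:ℝ) + (h:ℝ) * Complex.I) (hd.mono ?_)
    · simp only [Complex.add_re, Complex.add_im, Complex.ofReal_re, Complex.ofReal_im, Complex.re_ofReal_mul, Complex.im_ofReal_mul,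
        Complex.I_re, Complex.I_im, mul_zero, mul_one, add_zero, zero_add] at this
      linear_combination this
    · intro z hz
      have := (Complex.mem_reProdIm.1 hz).2
      simp at this
      rw [Set.uIcc_of_le (by linarith)] at this
      exact abs_le.2 this
  have hside : ∀ T : ℝ, ‖∫ y : ℝ in (-h)..h, G ((T:ℝ) + y * Complex.I)‖ ≤ C * Real.exp (-T^2) * (2 * h) := by
    intro T
    have := intervalIntegral.norm_integral_le_of_norm_le_const (a := -h) (b := h) (f := fun y : ℝ => G ((T:ℝ) + y * Complex.I)) (C := C * Real.exp (-T^2)) ?_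
    · rwa [show |h - -h| = 2 * h by rw [abs_of_pos] <;> linarith] at this
    · intro y hy
      rw [Set.uIoc_of_le (by linarith)] at hy
      exact hB T y (abs_le.2 ⟨hy.1.le, hy.2⟩)
  have hz : Filter.Tendsto (fun T : ℝ => C * Real.exp (-T^2) * (2 * h) + C * Real.exp (-T^2) * (2 * h)) Filter.atTop (nhds 0) := by
    have : Filter.Tendsto (fun T : ℝ => Real.exp (-T^2)) Filter.atTop (nhds 0) :=
      Real.tendsto_exp_atBot.comp (Filter.tendsto_neg_atTop_atBot.comp (Filter.tendsto_pow_atTop (by norm_num)))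
    have := ((this.const_mul C).mul_const (2 * h)).add ((this.const_mul C).mul_const (2 * h))
    simpa using this
  have t3 := t1.sub t2
  have t4 : Filter.Tendsto (fun T : ℝ => (∫ x : ℝ in -T..id T, G (x + (-h:ℝ) * Complex.I)) - (∫ x : ℝ in -T..id T, G (x + (h:ℝ) * Complex.I)))
      Filter.atTop (nhds 0) := by
    refine squeeze_zero_norm (fun T => ?_) hz
    simp only [id]
    rw [hrect T]
    refine (norm_sub_le _ _).trans ?_
    rw [norm_smul, norm_smul, Complex.norm_I, one_mul, one_mul]
    have := hside (-T)
    rw [neg_sq] at this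
    exact add_le_add this (hside T)
  exact sub_eq_zero.1 (tendsto_nhds_unique t3 t4)

lemma strip_re_im (n : ℕ) (w : ℂ) : ((n:ℂ) - W8 * w).re = n - Real.sqrt 2 / 2 * (w.re - w.im) ∧
    ((n:ℂ) - W8 * w).im = - (Real.sqrt 2 / 2 * (w.re + w.im)) := by
  simp [W8_re, W8_im]
  constructor <;> ring

lemma strip_diff (n : ℕ) (w : ℂ) (hw : |w.im| ≤ Real.sqrt 2 / 4) :
    |((n:ℂ) - W8 * w).re - ((n:ℂ) - W8 * w).im - n| ≤ 1/2 := by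
  obtain ⟨h1, h2⟩ := strip_re_im n w
  rw [h1, h2]
  have e : (n:ℝ) - Real.sqrt 2 / 2 * (w.re - w.im) - - (Real.sqrt 2 / 2 * (w.re + w.im)) - n = Real.sqrt 2 * w.im := by ring
  rw [e, abs_mul, abs_of_nonneg (Real.sqrt_nonneg 2)]
  nlinarith [Real.sqrt_nonneg 2, sqrt2_sq]

lemma strip_norm (n : ℕ) (hn : 1 ≤ n) (w : ℂ) (hw : |w.im| ≤ Real.sqrt 2 / 4) : 1/4 ≤ ‖(n:ℂ) - W8 * w‖ := by
  have h := abs_le.1 (strip_diff n w hw)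
  have hn' : (1:ℝ) ≤ n := by exact_mod_cast hn
  rw [Complex.norm_def, Complex.normSq_apply]
  refine Real.le_sqrt_of_sq_le ?_
  nlinarith [sq_nonneg (((n:ℂ) - W8 * w).re + ((n:ℂ) - W8 * w).im)]

lemma strip_slit (n : ℕ) (hn : 1 ≤ n) (w : ℂ) (hw : |w.im| ≤ Real.sqrt 2 / 4) : (n:ℂ) - W8 * w ∈ Complex.slitPlane := by
  have h := abs_le.1 (strip_diff n w hw)
  have hn' : (1:ℝ) ≤ n := by exact_mod_cast hn
  rw [Complex.mem_slitPlane_iff]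
  by_cases h0 : ((n:ℂ) - W8 * w).im = 0
  · left; linarith
  · right; exact h0

lemma den_zero (x : ℂ) (h : den x = 0) : ∃ k : ℤ, x = k := by
  have h1 : Complex.exp (Real.pi * Complex.I * x) = Complex.exp (-(Real.pi * Complex.I * x)) := sub_eq_zero.1 h
  obtain ⟨k, hk⟩ := Complex.exp_eq_exp_iff_exists_int.1 h1
  refine ⟨k, ?_⟩
  have hpi : (Real.pi : ℂ) ≠ 0 := by exact_mod_cast Real.pi_ne_zero
  have hI := Complex.I_ne_zero
  have : (2 * (Real.pi * Complex.I)) * x = (2 * (Real.pi * Complex.I)) * k := by linear_combination hk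
  exact mul_left_cancel₀ (by simp [hpi]) this

lemma strip_den (n : ℕ) (hn : 1 ≤ n) (w : ℂ) (hw : |w.im| ≤ Real.sqrt 2 / 4) (hw0 : w ≠ 0) : den ((n:ℂ) - W8 * w) ≠ 0 := by
  intro h0
  obtain ⟨k, hk⟩ := den_zero _ h0
  have h := strip_diff n w hw
  rw [hk] at h
  simp at h
  have h1 : |((k - n : ℤ):ℝ)| < 1 := by push_cast; linarith
  have h2 : k - n = 0 := by
    rw [← Int.cast_abs] at h1
    exact Int.abs_lt_one_iff.1 (by exact_mod_cast h1)
  have h3 : (k:ℂ) = n := by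
    have : k = n := by omega
    rw [this]; simp
  rw [h3] at hk
  have : W8 * w = 0 := by linear_combination -hk
  rcases mul_eq_zero.1 this with h | h
  · exact W8_ne h
  · exact hw0 h

noncomputable def kk (x : ℂ) : ℂ := Complex.exp (Real.pi * Complex.I * x ^ 2) / den x

noncomputable def GG (s : ℂ) (n : ℕ) (w : ℂ) : ℂ :=
  (-1)^n * Complex.exp (Real.pi * Complex.I * ((n:ℂ) - W8 * w)^2) *
    dslope (fun w => ((n:ℂ) - W8 * w)^(-s) - (n:ℂ)^(-s)) 0 w / dslope (fun w => den (-(W8 * w))) 0 w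

lemma den_at_zero : den 0 = 0 := by simp [den]

lemma den_shift (n : ℕ) (w : ℂ) : den ((n:ℂ) - W8 * w) = (-1)^n * den (-(W8 * w)) := by
  rw [← den_add_nat]; congr 1; ring

lemma GG_eq (s : ℂ) (n : ℕ) (w : ℂ) (hw0 : w ≠ 0) :
    GG s n w = KK s ((n:ℂ) - W8 * w) - (n:ℂ)^(-s) * kk ((n:ℂ) - W8 * w) := by
  rw [GG, dslope_of_ne _ hw0, dslope_of_ne _ hw0, slope_def_field, slope_def_field, KK, kk, den_shift]
  simp only [mul_zero, sub_zero, neg_zero, den_at_zero, sub_self]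
  have h1 : ((-1:ℂ)^n)⁻¹ = (-1)^n := by
    rw [← inv_pow]; norm_num
  rw [mul_div_assoc, div_div_div_cancel_right₀ hw0, div_eq_mul_inv, div_eq_mul_inv, div_eq_mul_inv, mul_inv, h1]
  ring

lemma GG_diff (s : ℂ) (n : ℕ) (hn : 1 ≤ n) : DifferentiableOn ℂ (GG s n) {z | |z.im| ≤ Real.sqrt 2 / 4} := by
  have hnhds : {z : ℂ | |z.im| ≤ Real.sqrt 2 / 4} ∈ nhds (0:ℂ) := by
    have : Continuous fun z : ℂ => |z.im| := by fun_prop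
    have h := this.continuousAt.preimage_mem_nhds (x := (0:ℂ)) (t := Set.Iic (Real.sqrt 2 / 4)) (by
      simp only [Complex.zero_im, abs_zero]
      exact Iic_mem_nhds (by positivity))
    exact h
  have hdd : Differentiable ℂ (fun w => den (-(W8 * w))) := by unfold den; fun_prop
  unfold GG
  refine DifferentiableOn.div (DifferentiableOn.mul ?_ ?_) ?_ ?_
  · fun_prop
  · rw [Complex.differentiableOn_dslope hnhds]
    intro w hw
    refine DifferentiableAt.differentiableWithinAt ?_
    have := strip_slit n hn w hw
    refine DifferentiableAt.sub_const ?_ _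
    exact DifferentiableAt.cpow_const (by fun_prop) this
  · rw [Complex.differentiableOn_dslope hnhds]
    exact hdd.differentiableOn
  · intro w hw
    by_cases hw0 : w = 0
    · subst hw0
      rw [dslope_same]
      have h1 : HasDerivAt (fun w => den (-(W8 * w))) (Real.pi * Complex.I * -W8 - -(Real.pi * Complex.I * -W8)) 0 := by
        unfold den
        have h2 : HasDerivAt (fun w : ℂ => Real.pi * Complex.I * -(W8 * w)) (Real.pi * Complex.I * -W8) 0 := by
          have := (((hasDerivAt_id (0:ℂ)).const_mul W8).neg).const_mul (Real.pi * Complex.I)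
          simpa using this
        have h3 := h2.cexp.sub h2.neg.cexp
        exact h3.congr_deriv (by simp)
      rw [h1.deriv]
      have hpi : (Real.pi : ℂ) ≠ 0 := by exact_mod_cast Real.pi_ne_zero
      have e : Real.pi * Complex.I * -W8 - -(Real.pi * Complex.I * -W8) = -2 * (Real.pi * Complex.I * W8) := by ring
      rw [e]
      simp [hpi, W8_ne]
    · rw [dslope_of_ne _ hw0, slope_def_field]
      simp only [mul_zero, neg_zero, den_at_zero, sub_zero]
      refine div_ne_zero ?_ hw0
      have := strip_den n hn w hw hw0
      rw [den_shift] at this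
      exact right_ne_zero_of_mul this

lemma den_far (x : ℂ) (hx : 1/2 ≤ |x.im|) : 1 ≤ ‖den x‖ := by
  have h1 : ‖Complex.exp (Real.pi * Complex.I * x)‖ = Real.exp (-(Real.pi * x.im)) := by
    rw [Complex.norm_exp]; congr 1; simp
  have h2 : ‖Complex.exp (-(Real.pi * Complex.I * x))‖ = Real.exp (Real.pi * x.im) := by
    rw [Complex.norm_exp]; congr 1; simp
  have h3 := abs_norm_sub_norm_le (Complex.exp (Real.pi * Complex.I * x)) (Complex.exp (-(Real.pi * Complex.I * x)))
  rw [h1, h2] at h3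
  refine le_trans ?_ h3
  have e : Real.exp (-(Real.pi * x.im)) - Real.exp (Real.pi * x.im) = -(2 * Real.sinh (Real.pi * x.im)) := by
    rw [Real.sinh_eq]; ring
  rw [e, abs_neg, abs_mul, Real.abs_sinh, abs_mul, abs_of_pos Real.pi_pos]
  have h4 : Real.pi * |x.im| ≤ Real.sinh (Real.pi * |x.im|) := Real.self_le_sinh_iff.2 (by positivity)
  have := Real.pi_gt_three
  rw [abs_of_pos (by norm_num : (0:ℝ) < 2)]
  nlinarith

lemma gauss_strip (n : ℕ) (u y : ℝ) (hy : |y| ≤ 1/2) :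
    ‖Complex.exp (Real.pi * Complex.I * ((n:ℂ) - W8 * (u + y * Complex.I))^2)‖ ≤ Real.exp ((5 * n)^2 + 5 * n + 1 - u^2) := by
  rw [Complex.norm_exp]
  have e : Real.pi * Complex.I * ((n:ℂ) - W8 * (u + y * Complex.I))^2 = Real.pi * Complex.I * (((n:ℝ)^2 : ℝ) - (2 * n : ℝ) * W8 * (u + y * Complex.I) + 
      Complex.I * (((u^2 - y^2 : ℝ) : ℂ) + (2 * u * y : ℝ) * Complex.I)) := by
    push_cast
    linear_combination (Real.pi * Complex.I * (u + y * Complex.I)^2) * W8_sq + (Real.pi * Complex.I * Complex.I * y^2) * Complex.I_sq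
  have e2 : (Real.pi * Complex.I * ((n:ℂ) - W8 * (u + y * Complex.I))^2).re = Real.pi * Real.sqrt 2 * n * (u + y) - Real.pi * (u^2 - y^2) := by
    rw [e, W8_eq]
    simp [-Complex.ofReal_pow]
    ring
  rw [e2]
  apply Real.exp_le_exp.2
  have hπ := Real.pi_gt_three
  have hπ2 := Real.pi_lt_d2
  have h6 : Real.sqrt 2 ≤ 1.5 := by
    rw [Real.sqrt_le_left (by norm_num)]; norm_num
  have hb : Real.pi * Real.sqrt 2 ≤ 5 := by
    have := Real.sqrt_nonneg 2
    nlinarith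
  have hb0 : 0 ≤ Real.pi * Real.sqrt 2 := by positivity
  have h7 : Real.pi * Real.sqrt 2 * n * (u + y) ≤ 5 * n * (|u| + 1/2) := by
    have : u + y ≤ |u| + 1/2 := by linarith [le_abs_self u, le_abs_self y]
    calc _ ≤ Real.pi * Real.sqrt 2 * n * (|u| + 1/2) := by gcongr
      _ ≤ _ := by gcongr
  have h8 : Real.pi * y^2 ≤ 1 := by
    have : y^2 ≤ 1/4 := by rw [← sq_abs]; nlinarith [abs_nonneg y]
    nlinarith
  have h9 : 3 * u^2 ≤ Real.pi * u^2 := by gcongr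
  have h10 : (5 * n) * |u| ≤ (5*n:ℝ)^2 + u^2 := by
    rw [← sq_abs u]
    nlinarith [sq_nonneg ((5*n:ℝ) - |u|), sq_nonneg ((5*n:ℝ)), sq_nonneg (|u|)]
  have : (0:ℝ) ≤ n := by positivity
  nlinarith [sq_nonneg u]

lemma cpow_strip (s : ℂ) (hs : 0 ≤ s.re) (x : ℂ) (hx : 1/4 ≤ ‖x‖) :
    ‖x^(-s)‖ ≤ (1/4:ℝ)^(-s.re) * Real.exp (Real.pi * |s.im|) := by
  have hne : x ≠ 0 := by
    intro h0; rw [h0, norm_zero] at hx; linarith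
  rw [Complex.norm_cpow_of_ne_zero hne, div_eq_mul_inv, ← Real.exp_neg]
  simp only [Complex.neg_re, Complex.neg_im, mul_neg, neg_neg]
  have h1 : ‖x‖ ^ (-s.re) ≤ (1/4:ℝ)^(-s.re) := Real.rpow_le_rpow_of_nonpos (by norm_num) hx (by linarith)
  have h2 : x.arg * s.im ≤ Real.pi * |s.im| := by
    calc x.arg * s.im ≤ |x.arg * s.im| := le_abs_self _
      _ = |x.arg| * |s.im| := abs_mul _ _
      _ ≤ _ := by gcongr; exact Complex.abs_arg_le_pi x
  gcongr

lemma sqrt2_4 : Real.sqrt 2 / 4 ≤ 1/2 := by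
  have h6 : Real.sqrt 2 ≤ 1.5 := by
    rw [Real.sqrt_le_left (by norm_num)]; norm_num
  linarith

lemma GG_bound (s : ℂ) (hs : 0 ≤ s.re) (n : ℕ) (hn : 1 ≤ n) : ∃ C : ℝ, ∀ u y : ℝ, |y| ≤ Real.sqrt 2 / 4 →
    ‖GG s n (u + y * Complex.I)‖ ≤ C * Real.exp (-u^2) := by
  -- near part
  have hcomp : IsCompact (Set.Icc (-2:ℝ) 2 ×ℂ Set.Icc (-(Real.sqrt 2 / 4)) (Real.sqrt 2 / 4)) :=
    isCompact_Icc.reProdIm isCompact_Icc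
  obtain ⟨C1, hC1⟩ := hcomp.exists_bound_of_continuousOn (f := GG s n) ((GG_diff s n hn).continuousOn.mono (by
    intro z hz
    exact abs_le.2 (Complex.mem_reProdIm.1 hz).2))
  set B := (1/4:ℝ)^(-s.re) * Real.exp (Real.pi * |s.im|) with hB
  have hB0 : 0 ≤ B := by positivity
  set E := Real.exp ((5 * n)^2 + 5 * n + 1) with hE
  refine ⟨|C1| * Real.exp 4 + 2 * B * E, fun u y hy => ?_⟩
  have hy2 : |y| ≤ 1/2 := hy.trans sqrt2_4
  rcases le_total |u| 2 with hu | hu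
  · have h1 := hC1 (u + y * Complex.I) (Complex.mem_reProdIm.2 ⟨by simpa using abs_le.1 hu, by simpa using abs_le.1 hy⟩)
    have h2 : 1 ≤ Real.exp 4 * Real.exp (-u^2) := by
      rw [← Real.exp_add]
      apply Real.one_le_exp
      rw [← sq_abs]
      nlinarith [abs_nonneg u]
    calc _ ≤ C1 := h1
      _ ≤ |C1| * 1 := by rw [mul_one]; exact le_abs_self _
      _ ≤ |C1| * (Real.exp 4 * Real.exp (-u^2)) := by gcongr
      _ ≤ _ := by
        have : 0 ≤ 2 * B * E * Real.exp (-u^2) := by positivity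
        nlinarith
  · have hw0 : (u + y * Complex.I : ℂ) ≠ 0 := by
      intro h0
      have := congrArg Complex.re h0
      simp at this
      rw [this, abs_zero] at hu
      linarith
    have hw : |(u + y * Complex.I : ℂ).im| ≤ Real.sqrt 2 / 4 := by simpa using hy
    rw [GG_eq s n _ hw0, KK, kk]
    set x := (n:ℂ) - W8 * (u + y * Complex.I) with hx
    have e : x^(-s) * Complex.exp (Real.pi * Complex.I * x^2) / den x - (n:ℂ)^(-s) * (Complex.exp (Real.pi * Complex.I * x^2) / den x)
      = (x^(-s) - (n:ℂ)^(-s)) * Complex.exp (Real.pi * Complex.I * x^2) / den x := by ring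
    rw [e, norm_div, norm_mul]
    have hd : 1 ≤ ‖den x‖ := by
      apply den_far
      rw [hx, (strip_re_im n _).2, abs_neg, abs_mul, abs_of_nonneg (by positivity)]
      simp
      have h14 : 1.4 ≤ Real.sqrt 2 := Real.le_sqrt_of_sq_le (by norm_num)
      have h3 : 3/2 ≤ |u + y| := by
        have := abs_sub_abs_le_abs_sub u (-y)
        rw [abs_neg, sub_neg_eq_add] at this
        linarith
      nlinarith
    have h1 := cpow_strip s hs x (strip_norm n hn _ hw)
    have h2 : ‖(n:ℂ)^(-s)‖ ≤ B := cpow_strip s hs n (by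
      have : (1:ℝ) ≤ n := by exact_mod_cast hn
      simp; linarith)
    have h3 : ‖x^(-s) - (n:ℂ)^(-s)‖ ≤ 2 * B := (norm_sub_le _ _).trans (by linarith)
    have h4 := gauss_strip n u y hy2
    rw [← hx] at h4
    have h5 : Real.exp ((5 * n)^2 + 5 * n + 1 - u^2) = E * Real.exp (-u^2) := by rw [hE, ← Real.exp_add]; congr 1
    rw [h5] at h4
    calc _ ≤ ‖x^(-s) - (n:ℂ)^(-s)‖ * ‖Complex.exp (Real.pi * Complex.I * x^2)‖ := div_le_self (by positivity) hd
      _ ≤ (2 * B) * (E * Real.exp (-u^2)) := by gcongr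
      _ ≤ _ := by
        have : 0 ≤ |C1| * Real.exp 4 * Real.exp (-u^2) := by positivity
        nlinarith

lemma kk_int (m : ℕ) : Integrable (fun u : ℝ => kk (((m + 1/2 : ℝ) : ℂ) - W8 * u)) := by
  have hden : ∀ u : ℝ, den (((m + 1/2 : ℝ) : ℂ) - W8 * u) ≠ 0 := by
    intro u h0
    have := den_lower m u
    rw [h0, norm_zero] at this
    linarith
  set c : ℝ := m + 1/2 with hc
  refine (gauss_int ((5 * c)^2)).mono' (Continuous.aestronglyMeasurable ?_) (Filter.Eventually.of_forall fun u => ?_)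
  · unfold kk
    refine Continuous.div (by fun_prop) ?_ hden
    unfold den; fun_prop
  · rw [kk, norm_div, norm_gauss]
    have h1 := den_lower m u
    rw [← hc] at h1
    refine (div_le_self (Real.exp_pos _).le (by linarith)).trans (Real.exp_le_exp.2 ?_)
    have hπ := Real.pi_gt_three
    have hπ2 := Real.pi_lt_d2
    have h6 : Real.sqrt 2 ≤ 1.5 := by
      rw [Real.sqrt_le_left (by norm_num)]; norm_num
    have hb : Real.pi * Real.sqrt 2 ≤ 5 := by
      have := Real.sqrt_nonneg 2
      nlinarith
    have hc0 : 0 ≤ c := by positivity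
    have h7 : Real.pi * Real.sqrt 2 * c * u ≤ 5 * c * |u| := by
      calc _ ≤ Real.pi * Real.sqrt 2 * c * |u| := by
            have := le_abs_self u
            gcongr
        _ ≤ _ := by gcongr
    have h9 : 3 * u^2 ≤ Real.pi * u^2 := by gcongr
    have h10 : (5 * c) * |u| ≤ (5*c:ℝ)^2 + u^2 := by
      rw [← sq_abs u]
      nlinarith [sq_nonneg ((5*c:ℝ) - |u|), sq_nonneg ((5*c:ℝ)), sq_nonneg (|u|)]
    nlinarith [sq_nonneg u]

lemma kk_diff (m : ℕ) (u : ℝ) : kk (((m + 1/2 : ℝ) : ℂ) - W8 * u) - kk ((((m + 1 : ℕ) + 1/2 : ℝ) : ℂ) - W8 * u) =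
    - Complex.exp (-(Real.pi : ℂ) * (u:ℂ)^2 + (-2 * Real.pi * Complex.I * (m+1) * W8) * u + Real.pi * Complex.I * ((m+1)^2 - 1/4)) := by
  set x : ℂ := ((m + 1/2 : ℝ) : ℂ) - W8 * u with hx
  have hden : den x ≠ 0 := by
    intro h0
    have := den_lower m u
    rw [← hx, h0, norm_zero] at this
    linarith
  have e1 : (((((m + 1 : ℕ) + 1/2 : ℝ)) : ℂ) - W8 * u) = x + 1 := by rw [hx]; push_cast; ring
  rw [e1, kk, kk, den_add_one]
  have e2 : Complex.exp (Real.pi * Complex.I * (x+1)^2) = - (Complex.exp (Real.pi * Complex.I * x^2) * Complex.exp (Real.pi * Complex.I * x)^2) := by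
    rw [← Complex.exp_nat_mul, ← Complex.exp_add, show Real.pi * Complex.I * (x+1)^2 = (Real.pi * Complex.I * x^2 + (2:ℕ) * (Real.pi * Complex.I * x)) + Real.pi * Complex.I by push_cast; ring,
      Complex.exp_add _ (Real.pi * Complex.I), Complex.exp_pi_mul_I]; ring
  have e3 : Complex.exp (-(Real.pi : ℂ) * (u:ℂ)^2 + (-2 * Real.pi * Complex.I * (m+1) * W8) * u + Real.pi * Complex.I * ((m+1)^2 - 1/4))
      = Complex.exp (Real.pi * Complex.I * x^2) * Complex.exp (Real.pi * Complex.I * x) := by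
    rw [← Complex.exp_add]
    congr 1
    rw [hx]; push_cast
    linear_combination (-Real.pi * Complex.I * u^2) * W8_sq - (Real.pi * u^2) * Complex.I_sq
  have e4 : Complex.exp (Real.pi * Complex.I * x) * den x = Complex.exp (Real.pi * Complex.I * x)^2 - 1 := by
    rw [den, mul_sub, ← Complex.exp_add, ← Complex.exp_add, add_neg_cancel, Complex.exp_zero, ← Complex.exp_nat_mul]
    push_cast; ring_nf
  rw [e2, e3]
  field_simp
  linear_combination e4

lemma kk_jump (m : ℕ) : (∫ u : ℝ, kk (((m + 1/2 : ℝ) : ℂ) - W8 * u)) - ∫ u : ℝ, kk ((((m + 1 : ℕ) + 1/2 : ℝ) : ℂ) - W8 * u) = - W8⁻¹ := by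
  rw [← integral_sub (kk_int m) (kk_int (m+1))]
  simp_rw [kk_diff m]
  rw [integral_neg, integral_cexp_quadratic (by simp [Real.pi_pos])]
  have hpi : (Real.pi : ℂ) ≠ 0 := by exact_mod_cast Real.pi_ne_zero
  rw [neg_neg, div_self hpi, Complex.one_cpow, one_mul, W8, ← Complex.exp_neg]
  congr 2
  have e : (-2 * Real.pi * Complex.I * (m+1) * Complex.exp (Real.pi * Complex.I / 4))^2 = 4 * Real.pi^2 * (-1) * (m+1)^2 * Complex.I := by
    have hW : Complex.exp (Real.pi * Complex.I / 4)^2 = Complex.I := W8_sq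
    linear_combination (4 * Real.pi^2 * Complex.I^2 * (m+1)^2) * hW + (4 * Real.pi^2 * (m+1)^2 * Complex.I) * Complex.I_sq
  rw [e]
  field_simp
  ring

lemma J_step (s : ℂ) (hs : 0 ≤ s.re) (m : ℕ) :
    (∫ u : ℝ, KK s (((m + 1/2 : ℝ) : ℂ) - W8 * u)) = (∫ u : ℝ, KK s ((((m + 1 : ℕ) + 1/2 : ℝ) : ℂ) - W8 * u)) - W8⁻¹ * ((m+1:ℕ):ℂ)^(-s) := by
  obtain ⟨C, hC⟩ := GG_bound s hs (m+1) (by omega)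
  obtain ⟨i1, i2, h12⟩ := line_shift (GG s (m+1)) (Real.sqrt 2 / 4) C (by positivity) (GG_diff s (m+1) (by omega)) hC
  have hpos : (0:ℝ) < Real.sqrt 2 / 4 := by positivity
  have hne : ∀ (u y : ℝ), y ≠ 0 → (u + y * Complex.I : ℂ) ≠ 0 := by
    intro u y hy h0
    have := congrArg Complex.im h0
    simp at this
    exact hy this
  have hWI : W8 * ((Real.sqrt 2 / 4 : ℝ) - (Real.sqrt 2 / 4 : ℝ) * Complex.I) = 1/2 := by
    rw [W8_eq]
    have : ((Real.sqrt 2 : ℝ) : ℂ) * ((Real.sqrt 2 : ℝ) : ℂ) = 2 := by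
      rw [← Complex.ofReal_mul, sqrt2_sq]; simp
    push_cast
    linear_combination (1/8 - Complex.I^2 / 8) * this - 1/4 * Complex.I_sq
  have x1 : ∀ u : ℝ, ((m+1:ℕ):ℂ) - W8 * (((u + Real.sqrt 2 / 4 : ℝ):ℂ) + (-(Real.sqrt 2 / 4) : ℝ) * Complex.I) = ((m + 1/2 : ℝ) : ℂ) - W8 * u := by
    intro u
    push_cast at hWI ⊢
    linear_combination -hWI
  have x2 : ∀ u : ℝ, ((m+1:ℕ):ℂ) - W8 * (((u - Real.sqrt 2 / 4 : ℝ):ℂ) + (Real.sqrt 2 / 4 : ℝ) * Complex.I) = (((m+1:ℕ) + 1/2 : ℝ) : ℂ) - W8 * u := by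
    intro u
    push_cast at hWI ⊢
    linear_combination hWI
  have k1 : ∀ u : ℝ, KK s (((m + 1/2 : ℝ) : ℂ) - W8 * u) = GG s (m+1) (((u + Real.sqrt 2 / 4 : ℝ):ℂ) + (-(Real.sqrt 2 / 4) : ℝ) * Complex.I) + ((m+1:ℕ):ℂ)^(-s) * kk (((m + 1/2 : ℝ) : ℂ) - W8 * u) := by
    intro u
    rw [GG_eq _ _ _ (hne _ _ (by linarith)), x1]; ring
  have k2 : ∀ u : ℝ, KK s ((((m+1:ℕ) + 1/2 : ℝ) : ℂ) - W8 * u) = GG s (m+1) (((u - Real.sqrt 2 / 4 : ℝ):ℂ) + (Real.sqrt 2 / 4 : ℝ) * Complex.I) + ((m+1:ℕ):ℂ)^(-s) * kk ((((m+1:ℕ) + 1/2 : ℝ) : ℂ) - W8 * u) := by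
    intro u
    rw [GG_eq _ _ _ (hne _ _ (by linarith)), x2]; ring
  simp_rw [k1, k2]
  rw [integral_add (i1.comp_add_right _) ((kk_int m).const_mul _), integral_add (i2.comp_sub_right _) ((kk_int (m+1)).const_mul _),
    integral_add_right_eq_self (fun u : ℝ => GG s (m+1) ((u:ℂ) + (-(Real.sqrt 2 / 4) : ℝ) * Complex.I)),
    integral_sub_right_eq_self (fun u : ℝ => GG s (m+1) ((u:ℂ) + ((Real.sqrt 2 / 4) : ℝ) * Complex.I)), h12,
    integral_const_mul, integral_const_mul]
  linear_combination ((m+1:ℕ):ℂ)^(-s) * kk_jump m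

lemma J_all (s : ℂ) (hs : 0 ≤ s.re) (N : ℕ) :
    (∫ u : ℝ, KK s ((((0:ℕ) + 1/2 : ℝ) : ℂ) - W8 * u)) =
      (∫ u : ℝ, KK s (((N + 1/2 : ℝ) : ℂ) - W8 * u)) - W8⁻¹ * ∑ n ∈ Finset.Ico 1 (N + 1), (n:ℂ)^(-s) := by
  induction N with
  | zero => simp
  | succ N ih =>
    rw [ih, J_step s hs N, Finset.sum_Ico_succ_top (show 1 ≤ N + 1 by omega)]
    ring

lemma RiemannR_eq (s : ℂ) : RiemannR s = -W8 * ∫ u : ℝ, KK s ((((0:ℕ) + 1/2 : ℝ) : ℂ) - W8 * u) := by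
  have e : ∀ u : ℝ, ((((0:ℕ) + 1/2 : ℝ) : ℂ) - W8 * u) = rline u := by
    intro u; rw [rline, W8]; push_cast; ring
  simp_rw [e]
  rfl

/-- There is `t₀` such that every zero of `R` with `Im ρ ≥ t₀` has `Re ρ < 1`. -/
theorem re_lt_one_of_zero_R_large_im :
    ∃ t₀ : ℝ, ∀ ρ : ℂ, RiemannR ρ = 0 → t₀ ≤ ρ.im → ρ.re < 1 := by
  obtain ⟨C, hC0, hC⟩ := remainder
  obtain ⟨t0, h8, h⟩ := dir_lower C hC0
  refine ⟨t0, fun ρ hρ ht => ?_⟩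
  by_contra hcon
  push Not at hcon
  have h1 := h ρ hcon ht
  have h2 := hC ρ hcon (h8.trans ht)
  rw [RiemannR_eq, J_all ρ (by linarith) (⌊Real.sqrt (ρ.im / (2 * Real.pi))⌋₊)] at hρ
  set D := ∑ n ∈ Finset.Ico 1 (⌊Real.sqrt (ρ.im / (2 * Real.pi))⌋₊ + 1), (n:ℂ)^(-ρ)
  set J := ∫ u : ℝ, KK ρ (((⌊Real.sqrt (ρ.im / (2 * Real.pi))⌋₊ + 1/2 : ℝ) : ℂ) - W8 * u)
  have h3 : D = W8 * J := by
    have : W8 * W8⁻¹ = 1 := mul_inv_cancel₀ W8_ne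
    linear_combination hρ - D * this
  rw [h3, norm_mul, W8_norm, one_mul] at h1
  linarith
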